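/- arXiv:1703.09406 — 2 statements merged into one kernel-verified Lean document; each statement's English description precedes it below -/
import Mathlib

section
/- There is a graph computable function, computable via a computable graph machine whose underlying colored graph is finitary (has a finite set of labels), that is Turing equivalent to 𝟎^(ω). -/
open scoped Classical
noncomputable section

/-! ### Oracle computability, Turing reducibility, and the Turing jump -/

/-- Codes for partial functions computable relative to an oracle `O : ℕ → ℕ`. -/
inductive OCode : Type
  | zero | succ | left | right | oracle
  | pair (a b : OCode)
  | comp (a b : OCode)
  | prec (a b : OCode)
  | rfind' (a : OCode)

/-- Evaluation of an oracle code relative to the oracle `O`. -/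
def OCode.eval (O : ℕ → ℕ) : OCode → ℕ →. ℕ
  | .zero => pure 0
  | .succ => fun n => Part.some (n + 1)
  | .left => fun n => Part.some (Nat.unpair n).1
  | .right => fun n => Part.some (Nat.unpair n).2
  | .oracle => fun n => Part.some (O n)
  | .pair cf cg => fun n => Nat.pair <$> OCode.eval O cf n <*> OCode.eval O cg n
  | .comp cf cg => fun n => OCode.eval O cg n >>= OCode.eval O cf
  | .prec cf cg =>
      Nat.unpaired fun a n =>
        n.rec (OCode.eval O cf a) fun y IH => do
          let i ← IH
          OCode.eval O cg (Nat.pair a (Nat.pair y i))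
  | .rfind' cf =>
      Nat.unpaired fun a m =>
        (Nat.rfind fun n => (fun x => x = 0) <$> OCode.eval O cf (Nat.pair a (n + m))).map (· + m)

/-- A standard surjective decoding of natural numbers as oracle codes. -/
def OCode.ofNat : ℕ → OCode
  | 0 => .zero
  | 1 => .succ
  | 2 => .left
  | 3 => .right
  | 4 => .oracle
  | (n + 5) =>
    have h1 : (n / 4).unpair.1 < n + 5 :=
      Nat.lt_succ_of_le (le_trans (Nat.unpair_left_le _)
        (le_trans (Nat.div_le_self n 4) (Nat.le_add_right n 4)))
    have h2 : (n / 4).unpair.2 < n + 5 :=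
      Nat.lt_succ_of_le (le_trans (Nat.unpair_right_le _)
        (le_trans (Nat.div_le_self n 4) (Nat.le_add_right n 4)))
    match n % 4 with
    | 0 => .pair (OCode.ofNat (n / 4).unpair.1) (OCode.ofNat (n / 4).unpair.2)
    | 1 => .comp (OCode.ofNat (n / 4).unpair.1) (OCode.ofNat (n / 4).unpair.2)
    | 2 => .prec (OCode.ofNat (n / 4).unpair.1) (OCode.ofNat (n / 4).unpair.2)
    | _ => .rfind' (OCode.ofNat (n / 4).unpair.1)

/-- `f` is Turing reducible to the oracle `g` (for total functions on `ℕ`). -/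
def TuringLE (f g : ℕ → ℕ) : Prop :=
  ∃ c : OCode, ∀ n, c.eval g n = Part.some (f n)

/-- Turing equivalence of total functions on `ℕ`. -/
def TuringEq (f g : ℕ → ℕ) : Prop := TuringLE f g ∧ TuringLE g f

/-- The Turing jump of an oracle. -/
def tjump (O : ℕ → ℕ) : ℕ → ℕ :=
  fun e => if ((OCode.ofNat e).eval O e).Dom then 1 else 0

/-- The `n`-th iterate of the Turing jump. -/
def tjumpIter (O : ℕ → ℕ) : ℕ → ℕ → ℕ
  | 0 => O
  | n + 1 => tjump (tjumpIter O n)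

/-- `𝟎^(n)`, the `n`-th jump of the computable degree. -/
def zeroN (n : ℕ) : ℕ → ℕ := tjumpIter (fun _ => 0) n

/-- `𝟎'`, the degree of the halting problem. -/
def zeroJump : ℕ → ℕ := zeroN 1

/-- The effective join `⨁ₙ F^(n)`. -/
def omegaIter (F : ℕ → ℕ) : ℕ → ℕ := fun p => tjumpIter F p.unpair.1 p.unpair.2

/-- `𝟎^(ω)`, the effective join of all `𝟎^(n)`. -/
def zeroOmega : ℕ → ℕ := omegaIter (fun _ => 0)

/-- The effective join of two oracles. -/
def oJoin (F G : ℕ → ℕ) : ℕ → ℕ :=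
  fun k => if k % 2 = 0 then F (k / 2) else G (k / 2)

/-- The characteristic function of a set of naturals. -/
def charFun (X : Set ℕ) : ℕ → ℕ := fun k => if k ∈ X then 1 else 0

/-- Kleene bracket: the `e`-th computable partial function. -/
def phi (e : ℕ) : ℕ →. ℕ := (Denumerable.ofNat Nat.Partrec.Code e).eval

/-! ### Colored graphs -/

/-- A colored graph with vertices, labels and colors drawn from `ℕ`.
`E v w` is the (finite) set of colors of edges from `v` to `w`, and `gam` is the
allowable colors function. -/
structure ColoredGraph where
  G : Set ℕ
  L : Set ℕ
  C : Set ℕ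
  V : ℕ → ℕ
  E : ℕ → ℕ → Finset ℕ
  gam : ℕ → Finset ℕ
  V_mem : ∀ v ∈ G, V v ∈ L
  E_sub : ∀ v w : ℕ, (E v w : Set ℕ) ⊆ C
  gam_sub : ∀ l ∈ L, (gam l : Set ℕ) ⊆ C
  E_allowed : ∀ v ∈ G, ∀ w ∈ G, E v w ⊆ gam (V v) ∩ gam (V w)

/-- A computable colored graph. -/
def ColoredGraph.Computable' (g : ColoredGraph) : Prop :=
  ComputablePred (· ∈ g.G) ∧ ComputablePred (· ∈ g.L) ∧ ComputablePred (· ∈ g.C) ∧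
    Computable g.V ∧
    Computable (fun p : ℕ × ℕ => Encodable.encode (g.E p.1 p.2)) ∧
    Computable (fun l => Encodable.encode (g.gam l))

/-- A colored graph is finitary if its set of labels is finite. -/
def ColoredGraph.Finitary (g : ColoredGraph) : Prop := g.L.Finite

/-- The set of vertices incident to `v`. -/
def ColoredGraph.degSet (g : ColoredGraph) (v : ℕ) : Set ℕ :=
  {w ∈ g.G | g.E v w ≠ ∅ ∨ g.E w v ≠ ∅}

/-- `g` has finite degree if every vertex has finitely many neighbours. -/
def ColoredGraph.FiniteDegree (g : ColoredGraph) : Prop :=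
  ∀ v ∈ g.G, (g.degSet v).Finite

/-- The degree function of `g` (as a total function on `ℕ`). -/
def ColoredGraph.degFun (g : ColoredGraph) : ℕ → ℕ :=
  fun v => if v ∈ g.G then (g.degSet v).ncard else 0

/-- `g` has constant (finite) degree. -/
def ColoredGraph.ConstantDegree (g : ColoredGraph) : Prop :=
  ∃ d : ℕ, ∀ v ∈ g.G, (g.degSet v).Finite ∧ (g.degSet v).ncard = d

/-- Adjacency in the underlying graph. -/
def ColoredGraph.Adj (g : ColoredGraph) (v w : ℕ) : Prop :=
  v ∈ g.G ∧ w ∈ g.G ∧ (g.E v w ≠ ∅ ∨ g.E w v ≠ ∅)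

/-- `A` is a connected subset (the vertex set of a connected subgraph) of `g`. -/
def ColoredGraph.ConnectedSubset (g : ColoredGraph) (A : Set ℕ) : Prop :=
  A ⊆ g.G ∧ ∀ v ∈ A, ∀ w ∈ A,
    Relation.ReflTransGen (fun a b => g.Adj a b ∧ a ∈ A ∧ b ∈ A) v w

/-- The 1-neighborhood of a set of vertices. -/
def ColoredGraph.nbhd (g : ColoredGraph) (A : Set ℕ) : Set ℕ :=
  A ∪ {v ∈ g.G | ∃ a ∈ A, g.E v a ≠ ∅ ∨ g.E a v ≠ ∅}

/-- Restriction of a colored graph to the induced subgraph on `B`. -/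
def ColoredGraph.restrict (g : ColoredGraph) (B : Set ℕ) : ColoredGraph :=
  { g with
    G := g.G ∩ B
    V_mem := fun v hv => g.V_mem v hv.1
    E_allowed := fun v hv w hw => g.E_allowed v hv.1 w hw.1 }

/-! ### Graph Turing machines -/

/-- A configuration assigns to each vertex a finite set of (received) colored pulses,
a displayed alphabet symbol, and a state. -/
abbrev Config := ℕ → Finset ℕ × ℕ × ℕ

/-- A graph Turing machine. -/
structure GraphMachine where
  graph : ColoredGraph
  A : Finset ℕ
  zero_mem : 0 ∈ A
  one_mem : 1 ∈ A
  S : Set ℕ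
  s : ℕ
  alpha : ℕ → Finset ℕ
  T : ℕ → Finset ℕ → ℕ → ℕ → Finset ℕ × ℕ × ℕ
  alpha_sub : ∀ l ∈ graph.L, (alpha l : Set ℕ) ⊆ S
  s_mem : ∀ l ∈ graph.L, s ∈ alpha l
  T_trivial : ∀ l c z t, (¬ c ⊆ graph.gam l ∨ t ∉ alpha l) → T l c z t = (c, z, t)
  T_compat : ∀ l c z t, t ∈ alpha l → c ⊆ graph.gam l → z ∈ A →
    (T l c z t).1 ⊆ graph.gam l ∧ (T l c z t).2.1 ∈ A ∧ (T l c z t).2.2 ∈ alpha l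
  T_init : ∀ l, T l ∅ 0 s = (∅, 0, s)

/-- A computable graph machine. -/
def GraphMachine.Computable' (M : GraphMachine) : Prop :=
  M.graph.Computable' ∧ ComputablePred (· ∈ M.S) ∧
    Computable (fun l => Encodable.encode (M.alpha l)) ∧
    Computable (fun q : ℕ × ℕ × ℕ × ℕ =>
      Encodable.encode
        (M.T q.1 ((Encodable.decode (α := Finset ℕ) q.2.1).getD ∅) q.2.2.1 q.2.2.2))

/-- A valid configuration for `M`. -/
def GraphMachine.Valid (M : GraphMachine) (f : Config) : Prop :=
  ∀ v ∈ M.graph.G, (f v).1 ⊆ M.graph.gam (M.graph.V v) ∧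
    (f v).2.2 ∈ M.alpha (M.graph.V v)

/-- The set of colored pulses received by `v` in one step from configuration `g`:
`⋃ w ∈ G, E w v ∩ (g w).1`. -/
def GraphMachine.pulses (M : GraphMachine) (g : Config) (v : ℕ) : Finset ℕ :=
  (M.graph.gam (M.graph.V v)).filter
    (fun c => ∃ w ∈ M.graph.G, c ∈ M.graph.E w v ∧ c ∈ (g w).1)

/-- One step of the machine. -/
def GraphMachine.step (M : GraphMachine) (g : Config) : Config :=
  fun v => M.T (M.graph.V v) (M.pulses g v) (g v).2.1 (g v).2.2

/-- The run of `M` on configuration `f`: `M.run f n v = ⟨M,f⟩(v,n)`. -/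
def GraphMachine.run (M : GraphMachine) (f : Config) : ℕ → Config
  | 0 => f
  | n + 1 => M.step (M.run f n)

/-- Restriction of a graph machine to the induced subgraph on `B`. -/
def GraphMachine.restrict (M : GraphMachine) (B : Set ℕ) : GraphMachine :=
  { M with graph := M.graph.restrict B }

/-- The restriction `f|_B` of a configuration (trivial data outside `B`). -/
def restrictConfig (M : GraphMachine) (f : Config) (B : Set ℕ) : Config :=
  fun v => if v ∈ B then f v else (∅, 0, M.s)

/-- The run of `M` on `f` halts at stage `n`. -/
def GraphMachine.HaltsAt (M : GraphMachine) (f : Config) (n : ℕ) : Prop :=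
  ∀ v ∈ M.graph.G, M.run f (n + 1) v = M.run f n v

/-- The run of `M` on `f` halts. -/
def GraphMachine.Halts (M : GraphMachine) (f : Config) : Prop :=
  ∃ n, M.HaltsAt f n

/-- The starting configuration determined by a display function `x`. -/
def GraphMachine.start (M : GraphMachine) (x : ℕ → ℕ) : Config :=
  fun v => (∅, x v, M.s)

/-- `x ∈ 𝔄^{<G}`: alphabet values on `G`, zero off `G`, finite support. -/
def GraphMachine.InDom (M : GraphMachine) (x : ℕ → ℕ) : Prop :=
  (∀ v ∈ M.graph.G, x v ∈ M.A) ∧ (∀ v ∉ M.graph.G, x v = 0) ∧ {v | x v ≠ 0}.Finite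

/-- The displayed symbols at the (first) halting stage of the run on `x̂`. -/
def GraphMachine.outputAt (M : GraphMachine) (x : ℕ → ℕ) : ℕ → ℕ :=
  fun v => (M.run (M.start x) (sInf {n | M.HaltsAt (M.start x) n}) v).2.1

/-- `{M}` is total. -/
def GraphMachine.Total (M : GraphMachine) : Prop :=
  ∀ x, M.InDom x → M.Halts (M.start x)

/-- Decoding a natural number as a finitely supported function `ℕ → ℕ`. -/
def decodeFS (n : ℕ) : ℕ → ℕ := fun v => (Denumerable.ofNat (List ℕ) n).getD v 0

/-- The function `{M}` as a total function on `ℕ` (input: code of a finitely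
supported display function paired with a vertex of `G`). -/
def GraphMachine.fn (M : GraphMachine) : ℕ → ℕ := fun p =>
  if M.InDom (decodeFS p.unpair.1) ∧ M.Halts (M.start (decodeFS p.unpair.1)) ∧
      p.unpair.2 ∈ M.graph.G then
    M.outputAt (decodeFS p.unpair.1) p.unpair.2
  else 0

/-- The restriction `x|_X` (zero outside `X`). -/
def restrictTo (X : Set ℕ) (x : ℕ → ℕ) : ℕ → ℕ :=
  fun v => if v ∈ X then x v else 0

/-- `ζ : 𝔄^{<X} → 𝔄^X` is `⟨𝒢,X⟩`-computable via `M`. -/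
def GraphMachine.ComputesVia (M : GraphMachine) (X : Set ℕ) (ζ : (ℕ → ℕ) → ℕ → ℕ) :
    Prop :=
  (∀ x, M.InDom x → M.Halts (M.start x)) ∧
  (∀ x y, M.InDom x → M.InDom y → restrictTo X x = restrictTo X y →
      ∀ v ∈ M.graph.G, M.outputAt x v = M.outputAt y v) ∧
  (∀ x, M.InDom x → ∀ v ∈ M.graph.G, v ∉ X → M.outputAt x v = 0) ∧
  (∀ x, M.InDom x → ∀ v ∈ X, M.outputAt x v = ζ (restrictTo X x) v)

/-- `ζ` is `⟨𝒢,X⟩`-computable via the computable machine `M`, where `X` is an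
infinite computable subset of `G`. -/
def GraphComputableVia (M : GraphMachine) (X : Set ℕ) (ζ : (ℕ → ℕ) → ℕ → ℕ) : Prop :=
  M.Computable' ∧ X.Infinite ∧ ComputablePred (· ∈ X) ∧ X ⊆ M.graph.G ∧
    M.ComputesVia X ζ

/-- `ζ` as a total function on `ℕ`. -/
def zetaFn (M : GraphMachine) (X : Set ℕ) (ζ : (ℕ → ℕ) → ℕ → ℕ) : ℕ → ℕ := fun p =>
  if (∀ v ∈ X, decodeFS p.unpair.1 v ∈ M.A) ∧ (∀ v ∉ X, decodeFS p.unpair.1 v = 0) ∧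
      p.unpair.2 ∈ X then
    ζ (decodeFS p.unpair.1) p.unpair.2
  else 0

/-- A configuration as a total function on `ℕ` (to serve as a Turing oracle). -/
def configFn (f : Config) : ℕ → ℕ := fun v => Encodable.encode (f v)

/-- The run of `M` on `f` as a total function on `ℕ`. -/
def runFn (M : GraphMachine) (f : Config) : ℕ → ℕ := fun p =>
  if p.unpair.1 ∈ M.graph.G then Encodable.encode (M.run f p.unpair.2 p.unpair.1) else 0

/-- A function `Finset ℕ → Finset ℕ` as a total function on `ℕ`. -/
def finsetFn (Θ : Finset ℕ → Finset ℕ) : ℕ → ℕ := fun k =>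
  Encodable.encode (Θ ((Encodable.decode (α := Finset ℕ) k).getD ∅))

/-- `(B i)_{i ≤ n}` is an `n`-approximation of `M` and `f` on `A`. -/
def IsApprox (M : GraphMachine) (f : Config) (n : ℕ) (B : ℕ → Set ℕ) (A : Set ℕ) :
    Prop :=
  B 0 = A ∧ (∀ i ≤ n, B i ⊆ M.graph.G) ∧ (∀ i < n, B i ⊆ B (i + 1)) ∧
  ∀ i < n, ∀ B' : Set ℕ, B (i + 1) ⊆ B' → B' ⊆ M.graph.G →
    ∀ v ∈ B (i + 1),
      (M.restrict (B (i + 1))).run (restrictConfig M (M.run f i) (B (i + 1))) 1 v =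
        (M.restrict B').run (restrictConfig M (M.run f i) B') 1 v

/-- The characteristic function of the collection `P n f` of `n`-approximations,
as a function on (codes of) pairs `(A, (B i)_{i ≤ n})` of finite sets. -/
def approxChar (M : GraphMachine) (f : Config) (n : ℕ) : ℕ → ℕ := fun k =>
  match Encodable.decode (α := Finset ℕ × List (Finset ℕ)) k with
  | some p =>
      if p.2.length = n + 1 ∧ ↑p.1 ⊆ M.graph.G ∧
          IsApprox M f n (fun i => ↑(p.2.getD i ∅)) ↑p.1 then 1 else 0
  | none => 0

/-- `Θ` is a uniform approximation of `M`. -/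
def UniformApprox (M : GraphMachine) (Θ : Finset ℕ → Finset ℕ) : Prop :=
  ∀ A : Finset ℕ, ↑A ⊆ M.graph.G →
    A ⊆ Θ A ∧ ↑(Θ A) ⊆ M.graph.G ∧
      ∀ f : Config, M.Valid f →
        IsApprox M f 1 (fun i => if i = 0 then (↑A : Set ℕ) else ↑(Θ A)) ↑A

/-- `M` halts within `c` steps on every starting configuration supported on a
finite connected subgraph. -/
def GraphMachine.HaltsWithin (M : GraphMachine) (c : ℕ) : Prop :=
  ∀ A : Set ℕ, A.Finite → M.graph.ConnectedSubset A →
    ∀ x : ℕ → ℕ, M.InDom x → (∀ v ∉ A, x v = 0) → M.HaltsAt (M.start x) c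

/-- `M` runs in linear space. -/
def GraphMachine.RunsInLinearSpace (M : GraphMachine) : Prop :=
  M.Total ∧ ∃ a b c d : ℕ,
    ∀ A : Set ℕ, A.Finite → M.graph.ConnectedSubset A →
      ∀ x : ℕ → ℕ, M.InDom x → (∀ v ∉ A, x v = 0) →
        (M.graph.nbhd^[a * A.ncard + b] A).encard ≤ (c * A.ncard + d : ℕ) ∧
        ∀ v ∈ A, ∀ n : ℕ,
          M.run (M.start x) n v =
            (M.restrict (M.graph.nbhd^[a * A.ncard + b] A)).run
              (restrictConfig M (M.start x) (M.graph.nbhd^[a * A.ncard + b] A)) n v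

/-! ### Iterated limits -/

/-- `lim_{k→∞} u k = a` for `ℕ`-valued sequences (eventual constancy). -/
def EvLim (u : ℕ → ℕ) (a : ℕ) : Prop := ∃ N, ∀ k ≥ N, u k = a

/-- `IterLim n F a`: the `n`-fold iterated limit
`lim_{x₀→∞} ⋯ lim_{x_{n-1}→∞} F (x₀, …, x_{n-1})` exists and equals `a`. -/
def IterLim : (n : ℕ) → ((Fin n → ℕ) → ℕ) → ℕ → Prop
  | 0, F, a => F (fun i => i.elim0) = a
  | n + 1, F, a =>
      ∃ u : ℕ → ℕ, (∀ x, IterLim n (fun xs => F (Fin.cons x xs)) (u x)) ∧ EvLim u a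

/-- `X` is `k`-computably enumerable (as a `{0,1}`-valued function `X : ℕ → ℕ`). -/
def KCE (X : ℕ → ℕ) (k : ℕ) : Prop :=
  ∃ g : ℕ → ℕ → ℕ, Computable₂ g ∧ (∀ n m, g n m ≤ 1) ∧ (∀ m, g 0 m = 0) ∧
    (∀ m, ∃ N, ∀ n ≥ N, g n m = X m) ∧
    (∀ m, {l : ℕ | g l m ≠ g (l + 1) m}.encard ≤ (k : ℕ∞))


/-! ### Basic facts about oracle codes -/

/-- A right inverse of `OCode.ofNat`. -/
def OCode.enc : OCode → ℕ
  | .zero => 0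
  | .succ => 1
  | .left => 2
  | .right => 3
  | .oracle => 4
  | .pair a b => 4 * Nat.pair (OCode.enc a) (OCode.enc b) + 5
  | .comp a b => 4 * Nat.pair (OCode.enc a) (OCode.enc b) + 1 + 5
  | .prec a b => 4 * Nat.pair (OCode.enc a) (OCode.enc b) + 2 + 5
  | .rfind' a => 4 * Nat.pair (OCode.enc a) 0 + 3 + 5

theorem OCode.ofNat_pair' (m : ℕ) :
    OCode.ofNat (4 * m + 5) = .pair (OCode.ofNat m.unpair.1) (OCode.ofNat m.unpair.2) := by
  rw [OCode.ofNat]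
  have h1 : 4 * m % 4 = 0 := by omega
  have h2 : 4 * m / 4 = m := by omega
  simp only [h1, h2]

theorem OCode.ofNat_comp' (m : ℕ) :
    OCode.ofNat (4 * m + 1 + 5) = .comp (OCode.ofNat m.unpair.1) (OCode.ofNat m.unpair.2) := by
  rw [OCode.ofNat]
  have h1 : (4 * m + 1) % 4 = 1 := by omega
  have h2 : (4 * m + 1) / 4 = m := by omega
  simp only [h1, h2]

theorem OCode.ofNat_prec' (m : ℕ) :
    OCode.ofNat (4 * m + 2 + 5) = .prec (OCode.ofNat m.unpair.1) (OCode.ofNat m.unpair.2) := by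
  rw [OCode.ofNat]
  have h1 : (4 * m + 2) % 4 = 2 := by omega
  have h2 : (4 * m + 2) / 4 = m := by omega
  simp only [h1, h2]

theorem OCode.ofNat_rfind' (m : ℕ) :
    OCode.ofNat (4 * m + 3 + 5) = .rfind' (OCode.ofNat m.unpair.1) := by
  rw [OCode.ofNat]
  have h1 : (4 * m + 3) % 4 = 3 := by omega
  have h2 : (4 * m + 3) / 4 = m := by omega
  simp only [h1, h2]

theorem OCode.ofNat_enc (c : OCode) : OCode.ofNat c.enc = c := by
  induction c with
  | zero => simp [OCode.enc, OCode.ofNat]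
  | succ => simp [OCode.enc, OCode.ofNat]
  | left => simp [OCode.enc, OCode.ofNat]
  | right => simp [OCode.enc, OCode.ofNat]
  | oracle => simp [OCode.enc, OCode.ofNat]
  | pair a b iha ihb => rw [OCode.enc, OCode.ofNat_pair']; simp [iha, ihb]
  | comp a b iha ihb => rw [OCode.enc, OCode.ofNat_comp']; simp [iha, ihb]
  | prec a b iha ihb => rw [OCode.enc, OCode.ofNat_prec']; simp [iha, ihb]
  | rfind' a iha => rw [OCode.enc, OCode.ofNat_rfind']; simp [iha]

/-- Embedding of ordinary codes into oracle codes. -/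
def OCode.ofCode : Nat.Partrec.Code → OCode
  | .zero => .zero
  | .succ => .succ
  | .left => .left
  | .right => .right
  | .pair a b => .pair (OCode.ofCode a) (OCode.ofCode b)
  | .comp a b => .comp (OCode.ofCode a) (OCode.ofCode b)
  | .prec a b => .prec (OCode.ofCode a) (OCode.ofCode b)
  | .rfind' a => .rfind' (OCode.ofCode a)

theorem OCode.eval_ofCode (O : ℕ → ℕ) (c : Nat.Partrec.Code) :
    (OCode.ofCode c).eval O = c.eval := by
  induction c with
  | zero => rfl
  | succ => rfl
  | left => rfl
  | right => rfl
  | pair a b iha ihb => simp only [OCode.ofCode, OCode.eval, iha, ihb]; rfl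
  | comp a b iha ihb => simp only [OCode.ofCode, OCode.eval, iha, ihb]; rfl
  | prec a b iha ihb => simp only [OCode.ofCode, OCode.eval, iha, ihb]; rfl
  | rfind' a iha =>
    simp only [OCode.ofCode, OCode.eval, iha, Nat.Partrec.Code.eval]
    congr! 7

theorem OCode.exists_of_computable {f : ℕ → ℕ} (hf : Computable f) :
    ∃ c : OCode, ∀ O n, c.eval O n = Part.some (f n) := by
  obtain ⟨c, hc⟩ := Nat.Partrec.Code.exists_code.1 (Partrec.nat_iff.1 hf)
  refine ⟨OCode.ofCode c, fun O n => ?_⟩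
  rw [OCode.eval_ofCode, hc]
  rfl

/-- One oracle query with computable pre- and postprocessing. -/
theorem OCode.exists_query {q : ℕ → ℕ} {h : ℕ → ℕ} (hq : Computable q) (hh : Computable h) :
    ∃ c : OCode, ∀ O n, c.eval O n = Part.some (h (Nat.pair n (O (q n)))) := by
  obtain ⟨cq, hcq⟩ := OCode.exists_of_computable hq
  obtain ⟨ch, hch⟩ := OCode.exists_of_computable hh
  obtain ⟨ci, hci⟩ := OCode.exists_of_computable Computable.id
  refine ⟨.comp ch (.pair ci (.comp .oracle cq)), fun O n => ?_⟩
  simp [OCode.eval, hcq, hci, Seq.seq]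
  exact (Part.bind_some _ _).trans (hch O _)

theorem TuringLE.of_query {f g : ℕ → ℕ} {q : ℕ → ℕ} {h : ℕ → ℕ → ℕ} (hq : Computable q)
    (hh : Computable₂ h) (H : ∀ n, f n = h n (g (q n))) : TuringLE f g := by
  have hh' : Computable (fun n : ℕ => h n.unpair.1 n.unpair.2) :=
    hh.comp (Computable.fst.comp Computable.unpair) (Computable.snd.comp Computable.unpair)
  obtain ⟨c, hc⟩ := OCode.exists_query hq hh'
  refine ⟨c, fun n => ?_⟩
  rw [hc, H]
  simp

/-! ### Levels of NOR gates: upper bound -/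

/-- The iterated circuit. -/
def VV (D : ℕ → ℕ → ℕ → Bool → Bool) : ℕ → ℕ → Prop
  | 0, _ => True
  | k + 1, a => ¬ ∃ i, D k a i (decide (VV D k i)) = true

/-- Number of the code of a constant function. -/
def constEnc : ℕ → ℕ
  | 0 => 0
  | n + 1 => 4 * Nat.pair 1 (constEnc n) + 1 + 5

theorem eval_constEnc (O : ℕ → ℕ) (n m : ℕ) :
    (OCode.ofNat (constEnc n)).eval O m = Part.some n := by
  induction n with
  | zero => simp [constEnc, OCode.ofNat, OCode.eval]; rfl
  | succ n ih =>
    rw [constEnc, OCode.ofNat_comp']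
    have : OCode.ofNat 1 = .succ := by simp [OCode.ofNat]
    simp [OCode.eval, ih, this]

/-- Number of the code running code `d` on input `⟨d, k, a⟩`. -/
def gfun (d k a : ℕ) : ℕ := 4 * Nat.pair d (constEnc (Nat.pair d (Nat.pair k a))) + 1 + 5

theorem eval_gfun (O : ℕ → ℕ) (d k a m : ℕ) :
    (OCode.ofNat (gfun d k a)).eval O m =
      (OCode.ofNat d).eval O (Nat.pair d (Nat.pair k a)) := by
  rw [gfun, OCode.ofNat_comp']
  simp [OCode.eval, eval_constEnc]
  exact Part.bind_some _ _

theorem primrec_constEnc : Primrec constEnc := by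
  have h : Primrec (fun n : ℕ => Nat.rec (motive := fun _ => ℕ) 0
      (fun _ IH => 4 * Nat.pair 1 IH + 1 + 5) n) := by
    refine Primrec.nat_rec₁ 0 (f := fun _ IH => 4 * Nat.pair 1 IH + 1 + 5) ?_
    refine Primrec.nat_add.comp (Primrec.nat_add.comp (Primrec.nat_mul.comp (Primrec.const 4)
      (Primrec₂.natPair.comp (Primrec.const 1) Primrec.snd)) (Primrec.const 1)) (Primrec.const 5)
  refine h.of_eq fun n => ?_
  induction n with
  | zero => rfl
  | succ n ih => simp only [constEnc]; rw [← ih]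

theorem primrec_gfun : Primrec (fun x : ℕ × ℕ × ℕ => gfun x.1 x.2.1 x.2.2) := by
  unfold gfun
  refine Primrec.nat_add.comp (Primrec.nat_add.comp (Primrec.nat_mul.comp (Primrec.const 4)
      (Primrec₂.natPair.comp Primrec.fst (primrec_constEnc.comp
        (Primrec₂.natPair.comp Primrec.fst (Primrec₂.natPair.comp
          (Primrec.fst.comp Primrec.snd) (Primrec.snd.comp Primrec.snd))))))
      (Primrec.const 1)) (Primrec.const 5)

theorem VV_upper {D : ℕ → ℕ → ℕ → Bool → Bool}
    (hD : Computable (fun x : (ℕ × ℕ) × ℕ × Bool => D x.1.1 x.1.2 x.2.1 x.2.2)) :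
    ∃ d : ℕ, ∀ k a, VV D k a ↔ zeroN k (gfun d k a) = 0 := by
  -- the inner test, on input `((d, (k+1, a)), i)`
  have hq : Computable (fun n : ℕ =>
      gfun n.unpair.1.unpair.1 (n.unpair.1.unpair.2.unpair.1 - 1) n.unpair.2) := by
    have u := Primrec.unpair
    have h1 : Primrec (fun n : ℕ => n.unpair.1) := Primrec.fst.comp u
    have h2 : Primrec (fun n : ℕ => n.unpair.2) := Primrec.snd.comp u
    exact (primrec_gfun.comp (Primrec.pair (h1.comp h1) (Primrec.pair
      (Primrec.nat_sub.comp (h1.comp (h2.comp h1)) (Primrec.const 1)) h2))).to_comp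
  have hh : Computable (fun y : ℕ =>
      cond (D (y.unpair.1.unpair.1.unpair.2.unpair.1 - 1) y.unpair.1.unpair.1.unpair.2.unpair.2
        y.unpair.1.unpair.2 (decide (y.unpair.2 = 0))) 0 1) := by
    have u := Primrec.unpair
    have h1 : Primrec (fun n : ℕ => n.unpair.1) := Primrec.fst.comp u
    have h2 : Primrec (fun n : ℕ => n.unpair.2) := Primrec.snd.comp u
    have h3 : Primrec (fun y : ℕ => decide (y.unpair.2 = 0)) := by
      refine Primrec.of_eq (PrimrecPred.decide (Primrec.eq.comp h2 (Primrec.const 0))) ?_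
      intro n; simp
    have e1 : Computable (fun y : ℕ => y.unpair.1.unpair.1.unpair.2.unpair.1 - 1) :=
      (Primrec.nat_sub.comp (h1.comp (h2.comp (h1.comp h1))) (Primrec.const 1)).to_comp
    have e2 : Computable (fun y : ℕ => y.unpair.1.unpair.1.unpair.2.unpair.2) :=
      (h2.comp (h2.comp (h1.comp h1))).to_comp
    have e3 : Computable (fun y : ℕ => y.unpair.1.unpair.2) := (h2.comp h1).to_comp
    have e4 := hD.comp (Computable.pair (Computable.pair e1 e2) (Computable.pair e3 h3.to_comp))
    exact Computable.cond e4 (Computable.const 0) (Computable.const 1)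
  obtain ⟨cf, hcf⟩ := OCode.exists_query hq hh
  obtain ⟨ci, hci⟩ := OCode.exists_of_computable
    (f := fun n => Nat.pair n 0) (Primrec₂.natPair.comp Primrec.id (Primrec.const 0)).to_comp
  let S : OCode := .comp (.rfind' cf) ci
  refine ⟨S.enc, fun k => ?_⟩
  induction k with
  | zero => intro a; simp [VV, zeroN, tjumpIter]
  | succ k ih =>
    intro a
    have key : ((OCode.ofNat (gfun S.enc (k+1) a)).eval (zeroN k) (gfun S.enc (k+1) a)).Dom ↔
        ∃ i, D k a i (decide (VV D k i)) = true := by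
      rw [eval_gfun, OCode.ofNat_enc]
      simp only [S, OCode.eval, hci, hcf, Nat.unpaired]
      simp only [Part.bind_eq_bind, Part.bind_some, Nat.unpair_pair, Part.map_some,
        Part.map_eq_map, Part.map_Dom, Nat.add_sub_cancel, Nat.add_zero]
      refine Nat.rfind_dom.trans ?_
      simp only [Part.mem_some_iff, Part.some_dom, implies_true, and_true]
      refine exists_congr fun i => ?_
      have hb : (decide (zeroN k (gfun S.enc k i) = 0)) = decide (VV D k i) := by
        simp [ih i]
      simp only [S] at hb
      rw [hb]
      cases D k a i (decide (VV D k i)) <;> simp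
    have e : zeroN (k+1) (gfun S.enc (k+1) a) =
      if ((OCode.ofNat (gfun S.enc (k+1) a)).eval (zeroN k) (gfun S.enc (k+1) a)).Dom
        then 1 else 0 := rfl
    rw [e]
    by_cases h : ((OCode.ofNat (gfun S.enc (k+1) a)).eval (zeroN k) (gfun S.enc (k+1) a)).Dom
    · rw [if_pos h]; simp only [VV]; simp [key.1 h]
    · rw [if_neg h]; simp only [VV]; rw [key] at h; simp only [h]; simp

/-! ### Evaluation relative to partial oracles and the use principle -/

/-- Evaluation of an oracle code relative to a partial oracle. -/
def OCode.evalP (P : ℕ → Part ℕ) : OCode → ℕ → Part ℕ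
  | .zero => fun _ => Part.some 0
  | .succ => fun n => Part.some (n + 1)
  | .left => fun n => Part.some (Nat.unpair n).1
  | .right => fun n => Part.some (Nat.unpair n).2
  | .oracle => fun n => P n
  | .pair cf cg => fun n => Nat.pair <$> OCode.evalP P cf n <*> OCode.evalP P cg n
  | .comp cf cg => fun n => (OCode.evalP P cg n).bind (OCode.evalP P cf)
  | .prec cf cg => fun p =>
        p.unpair.2.rec (OCode.evalP P cf p.unpair.1) fun y IH => IH.bind fun i =>
          OCode.evalP P cg (Nat.pair p.unpair.1 (Nat.pair y i))
  | .rfind' cf => fun p =>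
        (Nat.rfind fun n => (OCode.evalP P cf (Nat.pair p.unpair.1 (n + p.unpair.2))).map
          (fun x => decide (x = 0))).map (· + p.unpair.2)

/-- A total oracle as a partial oracle. -/
def totP (O : ℕ → ℕ) : ℕ → Part ℕ := fun n => Part.some (O n)

theorem OCode.evalP_total (O : ℕ → ℕ) (c : OCode) :
    c.evalP (totP O) = c.eval O := by
  induction c with
  | zero => rfl
  | succ => rfl
  | left => rfl
  | right => rfl
  | oracle => rfl
  | pair a b iha ihb => simp only [OCode.evalP, OCode.eval, iha, ihb]
  | comp a b iha ihb => simp only [OCode.evalP, OCode.eval, iha, ihb]; rfl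
  | prec a b iha ihb => simp only [OCode.evalP, OCode.eval, iha, ihb]; rfl
  | rfind' a iha => simp only [OCode.evalP, OCode.eval, iha]; rfl

theorem OCode.mem_pair {P : ℕ → Part ℕ} {a b : OCode} {n x : ℕ} :
    x ∈ (OCode.pair a b).evalP P n ↔
      ∃ u ∈ a.evalP P n, ∃ v ∈ b.evalP P n, Nat.pair u v = x := by
  simp [OCode.evalP, Seq.seq]

theorem OCode.mem_comp {P : ℕ → Part ℕ} {a b : OCode} {n x : ℕ} :
    x ∈ (OCode.comp a b).evalP P n ↔ ∃ u ∈ b.evalP P n, x ∈ a.evalP P u := by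
  simp only [OCode.evalP]
  exact Part.mem_bind_iff

theorem OCode.mem_prec_zero {P : ℕ → Part ℕ} {a b : OCode} {n x : ℕ} :
    x ∈ (OCode.prec a b).evalP P (Nat.pair n 0) ↔ x ∈ a.evalP P n := by
  simp [OCode.evalP]

theorem OCode.mem_prec_succ {P : ℕ → Part ℕ} {a b : OCode} {n m x : ℕ} :
    x ∈ (OCode.prec a b).evalP P (Nat.pair n (m + 1)) ↔
      ∃ u ∈ (OCode.prec a b).evalP P (Nat.pair n m),
        x ∈ b.evalP P (Nat.pair n (Nat.pair m u)) := by
  simp [OCode.evalP]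

theorem OCode.mem_rfind {P : ℕ → Part ℕ} {a : OCode} {n m x : ℕ} :
    x ∈ (OCode.rfind' a).evalP P (Nat.pair n m) ↔
      ∃ k, k + m = x ∧ 0 ∈ a.evalP P (Nat.pair n (k + m)) ∧
        ∀ j < k, ∃ v, v ≠ 0 ∧ v ∈ a.evalP P (Nat.pair n (j + m)) := by
  simp only [OCode.evalP, Nat.unpair_pair]
  refine (Part.mem_map_iff _).trans ?_
  refine exists_congr fun k => ?_
  refine (and_congr Nat.mem_rfind Iff.rfl).trans ?_
  simp only [Part.mem_map_iff]
  simp only [decide_eq_true_eq, decide_eq_false_iff_not, exists_eq_right, ne_eq]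
  constructor
  · rintro ⟨⟨h1, h2⟩, h3⟩
    exact ⟨h3, h1, fun j hj => let ⟨v, h4, h5⟩ := h2 hj; ⟨v, h5, h4⟩⟩
  · rintro ⟨h3, h1, h2⟩
    exact ⟨⟨h1, fun {j} hj => let ⟨v, h4, h5⟩ := h2 j hj; ⟨v, h5, h4⟩⟩, h3⟩

theorem OCode.evalP_mono {P Q : ℕ → Part ℕ} (h : ∀ q v, v ∈ P q → v ∈ Q q) (c : OCode) :
    ∀ n x, x ∈ c.evalP P n → x ∈ c.evalP Q n := by
  induction c with
  | zero => intro n x hx; exact hx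
  | succ => intro n x hx; exact hx
  | left => intro n x hx; exact hx
  | right => intro n x hx; exact hx
  | oracle => intro n x hx; exact h _ _ hx
  | pair a b iha ihb =>
    intro n x hx
    rw [OCode.mem_pair] at hx ⊢
    obtain ⟨u, hu, v, hv, e⟩ := hx
    exact ⟨u, iha _ _ hu, v, ihb _ _ hv, e⟩
  | comp a b iha ihb =>
    intro n x hx
    rw [OCode.mem_comp] at hx ⊢
    obtain ⟨u, hu, v⟩ := hx
    exact ⟨u, ihb _ _ hu, iha _ _ v⟩
  | prec a b iha ihb =>
    intro n
    rw [← Nat.pair_unpair n]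
    generalize n.unpair.1 = a0
    induction n.unpair.2 with
    | zero => intro x hx; rw [OCode.mem_prec_zero] at hx ⊢; exact iha _ _ hx
    | succ m ih =>
      intro x hx
      rw [OCode.mem_prec_succ] at hx ⊢
      obtain ⟨u, hu, hx⟩ := hx
      exact ⟨u, ih _ hu, ihb _ _ hx⟩
  | rfind' a iha =>
    intro n x hx
    rw [← Nat.pair_unpair n] at hx ⊢
    rw [OCode.mem_rfind] at hx ⊢
    obtain ⟨k, e, h0, h1⟩ := hx
    refine ⟨k, e, iha _ _ h0, fun j hj => ?_⟩
    obtain ⟨v, hv, hv'⟩ := h1 j hj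
    exact ⟨v, hv, iha _ _ hv'⟩

/-- The partial oracle given by a finite list. -/
def listP (l : List ℕ) : ℕ → Part ℕ := fun q => (l[q]? : Option ℕ)

theorem mem_listP {l : List ℕ} {q v : ℕ} : v ∈ listP l q ↔ l[q]? = some v := by
  simp [listP]

/-- Initial segment of an oracle. -/
def seg (O : ℕ → ℕ) (m : ℕ) : List ℕ := (List.range m).map O

theorem mem_listP_seg {O : ℕ → ℕ} {m q v : ℕ} : v ∈ listP (seg O m) q ↔ q < m ∧ O q = v := by
  rw [mem_listP, seg, List.getElem?_map]
  by_cases h : q < m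
  · simp [h]
  · simp [h]

theorem OCode.evalP_seg_mono {O : ℕ → ℕ} {m m' : ℕ} (h : m ≤ m') {c : OCode} {n x : ℕ}
    (hx : x ∈ c.evalP (listP (seg O m)) n) : x ∈ c.evalP (listP (seg O m')) n := by
  refine OCode.evalP_mono (fun q v => ?_) c n x hx
  rw [mem_listP_seg, mem_listP_seg]
  exact fun ⟨h1, h2⟩ => ⟨h1.trans_le h, h2⟩

theorem OCode.use {O : ℕ → ℕ} (c : OCode) :
    ∀ n x, x ∈ c.evalP (totP O) n → ∃ m, x ∈ c.evalP (listP (seg O m)) n := by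
  induction c with
  | zero => intro n x hx; exact ⟨0, hx⟩
  | succ => intro n x hx; exact ⟨0, hx⟩
  | left => intro n x hx; exact ⟨0, hx⟩
  | right => intro n x hx; exact ⟨0, hx⟩
  | oracle =>
    intro n x hx
    refine ⟨n + 1, ?_⟩
    change x ∈ listP (seg O (n + 1)) n
    rw [mem_listP_seg]
    exact ⟨Nat.lt_succ_self n, ((Part.mem_some_iff).1 hx).symm⟩
  | pair a b iha ihb =>
    intro n x hx
    rw [OCode.mem_pair] at hx
    obtain ⟨u, hu, v, hv, e⟩ := hx
    obtain ⟨m1, h1⟩ := iha _ _ hu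
    obtain ⟨m2, h2⟩ := ihb _ _ hv
    exact ⟨max m1 m2, OCode.mem_pair.2 ⟨u, OCode.evalP_seg_mono (le_max_left _ _) h1, v,
      OCode.evalP_seg_mono (le_max_right _ _) h2, e⟩⟩
  | comp a b iha ihb =>
    intro n x hx
    rw [OCode.mem_comp] at hx
    obtain ⟨u, hu, hv⟩ := hx
    obtain ⟨m1, h1⟩ := ihb _ _ hu
    obtain ⟨m2, h2⟩ := iha _ _ hv
    exact ⟨max m1 m2, OCode.mem_comp.2 ⟨u, OCode.evalP_seg_mono (le_max_left _ _) h1,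
      OCode.evalP_seg_mono (le_max_right _ _) h2⟩⟩
  | prec a b iha ihb =>
    intro n
    rw [← Nat.pair_unpair n]
    generalize n.unpair.1 = a0
    induction n.unpair.2 with
    | zero => intro x hx; simp only [OCode.mem_prec_zero] at hx ⊢; exact iha _ _ hx
    | succ m ih =>
      intro x hx
      rw [OCode.mem_prec_succ] at hx
      obtain ⟨u, hu, hx⟩ := hx
      obtain ⟨m1, h1⟩ := ih _ hu
      obtain ⟨m2, h2⟩ := ihb _ _ hx
      exact ⟨max m1 m2, OCode.mem_prec_succ.2 ⟨u, OCode.evalP_seg_mono (le_max_left _ _) h1,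
        OCode.evalP_seg_mono (le_max_right _ _) h2⟩⟩
  | rfind' a iha =>
    intro n x hx
    rw [← Nat.pair_unpair n] at hx ⊢
    rw [OCode.mem_rfind] at hx
    obtain ⟨k, e, h0, h1⟩ := hx
    obtain ⟨m0, hm0⟩ := iha _ _ h0
    have : ∀ j, ∃ m, j < k → ∃ v, v ≠ 0 ∧
        v ∈ a.evalP (listP (seg O m)) (Nat.pair n.unpair.1 (j + n.unpair.2)) := by
      intro j
      by_cases hj : j < k
      · obtain ⟨v, hv, hv'⟩ := h1 j hj
        obtain ⟨m, hm⟩ := iha _ _ hv'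
        exact ⟨m, fun _ => ⟨v, hv, hm⟩⟩
      · exact ⟨0, fun h => absurd h hj⟩
    choose f hf using this
    refine ⟨max m0 ((Finset.range k).sup f), OCode.mem_rfind.2 ⟨k, e,
      OCode.evalP_seg_mono (le_max_left _ _) hm0, fun j hj => ?_⟩⟩
    obtain ⟨v, hv, hv'⟩ := hf j hj
    refine ⟨v, hv, OCode.evalP_seg_mono (le_trans ?_ (le_max_right _ _)) hv'⟩
    exact Finset.le_sup (f := f) (Finset.mem_range.2 hj)

/-- Halting relative to `O` is witnessed by a finite list of true oracle answers. -/
theorem OCode.dom_iff {O : ℕ → ℕ} {c : OCode} {n : ℕ} :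
    (c.eval O n).Dom ↔
      ∃ l : List ℕ, (∀ q v, l[q]? = some v → O q = v) ∧ (c.evalP (listP l) n).Dom := by
  rw [← OCode.evalP_total]
  constructor
  · intro h
    obtain ⟨m, hm⟩ := OCode.use c n _ (Part.get_mem h)
    refine ⟨seg O m, fun q v hv => ?_, Part.dom_iff_mem.2 ⟨_, hm⟩⟩
    rw [← mem_listP, mem_listP_seg] at hv
    exact hv.2
  · rintro ⟨l, hl, hd⟩
    refine Part.dom_iff_mem.2 ⟨_, OCode.evalP_mono (fun q v hv => ?_) c n _ (Part.get_mem hd)⟩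
    rw [mem_listP] at hv
    exact Part.mem_some_iff.2 (hl q v hv).symm

/-! ### Translation into ordinary codes -/

open Nat.Partrec (Code) in
/-- Translation of an oracle code into an ordinary code with the finite oracle as a parameter;
`c0` looks up the finite oracle. -/
def OCode.tr (c0 : Code) : OCode → Code
  | .zero => .zero
  | .succ => .comp .succ .right
  | .left => .comp .left .right
  | .right => .comp .right .right
  | .oracle => c0
  | .pair a b => .pair (OCode.tr c0 a) (OCode.tr c0 b)
  | .comp a b => .comp (OCode.tr c0 a) (.pair .left (OCode.tr c0 b))
  | .prec a b =>
      .comp (.prec (OCode.tr c0 a) (.comp (OCode.tr c0 b)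
          (.pair (.comp .left .left) (.pair (.comp .right .left) .right))))
        (.pair (.pair .left (.comp .left .right)) (.comp .right .right))
  | .rfind' a =>
      .comp (.rfind' (.comp (OCode.tr c0 a)
          (.pair (.comp .left .left) (.pair (.comp .right .left) .right))))
        (.pair (.pair .left (.comp .left .right)) (.comp .right .right))

open Nat.Partrec (Code) in
theorem Code.mem_pair {a b : Code} {n x : ℕ} :
    x ∈ (Code.pair a b).eval n ↔ ∃ u ∈ a.eval n, ∃ v ∈ b.eval n, Nat.pair u v = x := by
  simp [Code.eval, Seq.seq]

open Nat.Partrec (Code) in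
theorem Code.mem_comp {a b : Code} {n x : ℕ} :
    x ∈ (Code.comp a b).eval n ↔ ∃ u ∈ b.eval n, x ∈ a.eval u :=
  Part.mem_bind_iff

open Nat.Partrec (Code) in
theorem Code.mem_prec_succ {a b : Code} {n m x : ℕ} :
    x ∈ (Code.prec a b).eval (Nat.pair n (m + 1)) ↔
      ∃ u ∈ (Code.prec a b).eval (Nat.pair n m),
        x ∈ b.eval (Nat.pair n (Nat.pair m u)) := by
  rw [Code.eval_prec_succ]
  exact Part.mem_bind_iff

open Nat.Partrec (Code) in
theorem Code.mem_rfind {a : Code} {n m x : ℕ} :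
    x ∈ (Code.rfind' a).eval (Nat.pair n m) ↔
      ∃ k, k + m = x ∧ 0 ∈ a.eval (Nat.pair n (k + m)) ∧
        ∀ j < k, ∃ v, v ≠ 0 ∧ v ∈ a.eval (Nat.pair n (j + m)) := by
  simp only [Code.eval, Nat.unpaired, Nat.unpair_pair]
  refine (Part.mem_map_iff _).trans ?_
  refine exists_congr fun k => ?_
  refine (and_congr Nat.mem_rfind Iff.rfl).trans ?_
  simp only [Part.map_eq_map, Part.mem_map_iff]
  simp only [decide_eq_true_eq, decide_eq_false_iff_not, exists_eq_right, ne_eq]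
  constructor
  · rintro ⟨⟨h1, h2⟩, h3⟩
    exact ⟨h3, h1, fun j hj => let ⟨v, h4, h5⟩ := h2 hj; ⟨v, h5, h4⟩⟩
  · rintro ⟨h3, h1, h2⟩
    exact ⟨⟨h1, fun {j} hj => let ⟨v, h4, h5⟩ := h2 j hj; ⟨v, h5, h4⟩⟩, h3⟩

open Nat.Partrec (Code) in
theorem Code.mem_left {n x : ℕ} : x ∈ Code.left.eval n ↔ x = n.unpair.1 := by
  simp [Code.eval]

open Nat.Partrec (Code) in
theorem Code.mem_right {n x : ℕ} : x ∈ Code.right.eval n ↔ x = n.unpair.2 := by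
  simp [Code.eval]

open Nat.Partrec (Code) in
theorem Code.mem_succ {n x : ℕ} : x ∈ Code.succ.eval n ↔ x = n + 1 := by
  simp [Code.eval]

open Nat.Partrec (Code) in
theorem OCode.eval_tr {c0 : Code}
    (h0 : ∀ s n x, x ∈ c0.eval (Nat.pair s n) ↔ x ∈ listP (Denumerable.ofNat (List ℕ) s) n)
    (c : OCode) (s : ℕ) : ∀ n x, x ∈ (OCode.tr c0 c).eval (Nat.pair s n) ↔
      x ∈ c.evalP (listP (Denumerable.ofNat (List ℕ) s)) n := by
  induction c with
  | zero => intro n x; rfl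
  | succ =>
    intro n x; simp [OCode.tr, Code.mem_comp, Code.mem_right, Code.mem_succ, OCode.evalP]
  | left =>
    intro n x; simp [OCode.tr, Code.mem_comp, Code.mem_right, Code.mem_left, OCode.evalP]
  | right =>
    intro n x; simp [OCode.tr, Code.mem_comp, Code.mem_right, OCode.evalP]
  | oracle => intro n x; exact h0 s n x
  | pair a b iha ihb =>
    intro n x
    simp only [OCode.tr, Code.mem_pair, OCode.mem_pair, iha, ihb]
  | comp a b iha ihb =>
    intro n x
    simp [OCode.tr, Code.mem_pair, Code.mem_comp, OCode.mem_comp, iha, ihb, Code.mem_left]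
  | prec a b iha ihb =>
    intro n
    rw [← Nat.pair_unpair n]
    generalize n.unpair.1 = a0
    generalize n.unpair.2 = m
    intro x
    simp only [OCode.tr]
    rw [Code.mem_comp]
    simp only [Code.mem_pair, Code.mem_comp, Code.mem_left, Code.mem_right, exists_eq_left,
      Nat.unpair_pair, exists_eq_left']
    induction m generalizing x with
    | zero => rw [Code.eval_prec_zero, OCode.mem_prec_zero, iha]
    | succ m ih =>
      rw [Code.mem_prec_succ, OCode.mem_prec_succ]
      refine exists_congr fun u => ?_
      rw [ih]
      simp [Code.mem_pair, Code.mem_comp, Code.mem_left, Code.mem_right, ihb]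
  | rfind' a iha =>
    intro n
    rw [← Nat.pair_unpair n]
    generalize n.unpair.1 = a0
    generalize n.unpair.2 = m
    intro x
    simp only [OCode.tr]
    rw [Code.mem_comp]
    simp only [Code.mem_pair, Code.mem_comp, Code.mem_left, Code.mem_right, exists_eq_left,
      Nat.unpair_pair, exists_eq_left']
    rw [Code.mem_rfind, OCode.mem_rfind]
    simp [Code.mem_pair, Code.mem_comp, Code.mem_left, Code.mem_right, iha]

/-! ### The concrete circuit and the lower bound -/

open Nat.Partrec (Code)

theorem exists_lookup_code : ∃ c0 : Code, ∀ s n x, x ∈ c0.eval (Nat.pair s n) ↔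
    x ∈ listP (Denumerable.ofNat (List ℕ) s) n := by
  have h : Partrec (fun p : ℕ =>
      ((Denumerable.ofNat (List ℕ) p.unpair.1)[p.unpair.2]? : Part ℕ)) := by
    refine Computable.ofOption (f := fun p : ℕ =>
      (Denumerable.ofNat (List ℕ) p.unpair.1)[p.unpair.2]?) ?_
    exact (Primrec.list_getElem?.comp ((Primrec.ofNat _).comp (Primrec.fst.comp Primrec.unpair))
      (Primrec.snd.comp Primrec.unpair)).to_comp
  obtain ⟨c, hc⟩ := Code.exists_code.1 (Partrec.nat_iff.1 h)
  refine ⟨c, fun s n x => ?_⟩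
  rw [hc]
  simp [listP]

/-- The lookup code. -/
def c0 : Code := Classical.choose exists_lookup_code

/-- Translation of the code with a given number. -/
def trN (e : ℕ) : Code := OCode.tr c0 (OCode.ofNat e)

/-- `prec` clause. -/
def trPrec (a b : Code) : Code :=
  .comp (.prec a (.comp b
          (.pair (.comp .left .left) (.pair (.comp .right .left) .right))))
        (.pair (.pair .left (.comp .left .right)) (.comp .right .right))

/-- `rfind'` clause. -/
def trRf (a : Code) : Code :=
  .comp (.rfind' (.comp a
          (.pair (.comp .left .left) (.pair (.comp .right .left) .right))))
        (.pair (.pair .left (.comp .left .right)) (.comp .right .right))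

/-- Recursion step for `trN`. -/
def trStep (l : List Code) : Code :=
  if l.length = 0 then .zero
  else if l.length = 1 then .comp .succ .right
  else if l.length = 2 then .comp .left .right
  else if l.length = 3 then .comp .right .right
  else if l.length = 4 then c0
  else if (l.length - 5) % 4 = 0 then
    .pair (l.getD ((l.length - 5) / 4).unpair.1 .zero) (l.getD ((l.length - 5) / 4).unpair.2 .zero)
  else if (l.length - 5) % 4 = 1 then
    .comp (l.getD ((l.length - 5) / 4).unpair.1 .zero)
      (.pair .left (l.getD ((l.length - 5) / 4).unpair.2 .zero))
  else if (l.length - 5) % 4 = 2 then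
    trPrec (l.getD ((l.length - 5) / 4).unpair.1 .zero)
      (l.getD ((l.length - 5) / 4).unpair.2 .zero)
  else trRf (l.getD ((l.length - 5) / 4).unpair.1 .zero)

theorem primrec_trStep : Primrec trStep := by
  have hl : Primrec (fun l : List Code => l.length) := Primrec.list_length
  have hn : Primrec (fun l : List Code => l.length - 5) :=
    Primrec.nat_sub.comp hl (Primrec.const 5)
  have hr : Primrec (fun l : List Code => (l.length - 5) % 4) :=
    Primrec.nat_mod.comp hn (Primrec.const 4)
  have hm : Primrec (fun l : List Code => ((l.length - 5) / 4).unpair) :=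
    Primrec.unpair.comp (Primrec.nat_div.comp hn (Primrec.const 4))
  have ha : Primrec (fun l : List Code => l.getD ((l.length - 5) / 4).unpair.1 .zero) :=
    (Primrec.list_getD Code.zero).comp Primrec.id (Primrec.fst.comp hm)
  have hb : Primrec (fun l : List Code => l.getD ((l.length - 5) / 4).unpair.2 .zero) :=
    (Primrec.list_getD Code.zero).comp Primrec.id (Primrec.snd.comp hm)
  have hP : Primrec₂ trPrec := by
    refine Code.primrec₂_comp.comp (Code.primrec₂_prec.comp Primrec.fst
      (Code.primrec₂_comp.comp Primrec.snd (Primrec.const _))) (Primrec.const _)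
  have hR : Primrec trRf := by
    refine Code.primrec₂_comp.comp (Code.primrec_rfind'.comp
      (Code.primrec₂_comp.comp Primrec.id (Primrec.const _))) (Primrec.const _)
  refine Primrec.ite (Primrec.eq.comp hl (Primrec.const 0)) (Primrec.const _) ?_
  refine Primrec.ite (Primrec.eq.comp hl (Primrec.const 1)) (Primrec.const _) ?_
  refine Primrec.ite (Primrec.eq.comp hl (Primrec.const 2)) (Primrec.const _) ?_
  refine Primrec.ite (Primrec.eq.comp hl (Primrec.const 3)) (Primrec.const _) ?_
  refine Primrec.ite (Primrec.eq.comp hl (Primrec.const 4)) (Primrec.const _) ?_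
  refine Primrec.ite (Primrec.eq.comp hr (Primrec.const 0)) (Code.primrec₂_pair.comp ha hb) ?_
  refine Primrec.ite (Primrec.eq.comp hr (Primrec.const 1)) (Code.primrec₂_comp.comp ha
    (Code.primrec₂_pair.comp (Primrec.const _) hb)) ?_
  exact Primrec.ite (Primrec.eq.comp hr (Primrec.const 2)) (hP.comp ha hb) (hR.comp ha)

theorem trStep_spec (e : ℕ) : trStep ((List.range e).map trN) = trN e := by
  rcases e with _ | _ | _ | _ | _ | n
  · simp [trStep, trN, OCode.ofNat, OCode.tr]
  · simp [trStep, trN, OCode.ofNat, OCode.tr]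
  · simp [trStep, trN, OCode.ofNat, OCode.tr]
  · simp [trStep, trN, OCode.ofNat, OCode.tr]
  · simp [trStep, trN, OCode.ofNat, OCode.tr]
  · have h1 : (n / 4).unpair.1 < n + 5 :=
      Nat.lt_succ_of_le (le_trans (Nat.unpair_left_le _)
        (le_trans (Nat.div_le_self n 4) (Nat.le_add_right n 4)))
    have h2 : (n / 4).unpair.2 < n + 5 :=
      Nat.lt_succ_of_le (le_trans (Nat.unpair_right_le _)
        (le_trans (Nat.div_le_self n 4) (Nat.le_add_right n 4)))
    have g1 : ((List.range (n + 5)).map trN).getD (n / 4).unpair.1 .zero =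
        trN (n / 4).unpair.1 := by
      simp [List.getD_eq_getElem?_getD, h1]
    have g2 : ((List.range (n + 5)).map trN).getD (n / 4).unpair.2 .zero =
        trN (n / 4).unpair.2 := by
      simp [List.getD_eq_getElem?_getD, h2]
    have hl : ((List.range (n + 5)).map trN).length = n + 5 := by simp
    change trStep ((List.range (n + 5)).map trN) = trN (n + 5)
    rw [trStep]
    simp only [hl, Nat.add_sub_cancel, g1, g2]
    have h4 : n % 4 < 4 := Nat.mod_lt _ (by norm_num)
    have hdm := Nat.div_add_mod n 4
    have e0 : ∀ r, n % 4 = r → trN (n + 5) = OCode.tr c0 (OCode.ofNat (4 * (n / 4) + r + 5)) := by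
      intro r hr
      rw [← hr, hdm]; rfl
    interval_cases hr : n % 4
    · rw [e0 0 rfl, Nat.add_zero, OCode.ofNat_pair']; simp [OCode.tr, trN]
    · rw [e0 1 rfl, OCode.ofNat_comp']; simp [OCode.tr, trN]
    · rw [e0 2 rfl, OCode.ofNat_prec']; simp [OCode.tr, trN, trPrec]
    · rw [e0 3 rfl, OCode.ofNat_rfind']; simp [OCode.tr, trN, trRf]

theorem primrec_trN : Primrec trN := by
  have h : Primrec₂ (fun (_ : Unit) (n : ℕ) => trN n) := by
    refine Primrec.nat_strong_rec _ (g := fun _ l => some (trStep l)) ?_ ?_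
    · exact (Primrec.option_some.comp (primrec_trStep.comp Primrec.snd)).to₂
    · intro _ n
      rw [trStep_spec]
  exact h.comp (Primrec.const ()) Primrec.id

/-- The edge relation of the circuit. -/
def DD (k a i : ℕ) (b : Bool) : Bool :=
  if k % 2 = 0 then
    ((Denumerable.ofNat (List ℕ) a.unpair.1)[i]?.map
      (fun v => !(decide (v = if b = true then 0 else 1)))).getD false
  else b && (Code.evaln i.unpair.2 (trN a) (Nat.pair i.unpair.1 a)).isSome

theorem primrec_DD : Primrec (fun x : (ℕ × ℕ) × ℕ × Bool => DD x.1.1 x.1.2 x.2.1 x.2.2) := by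
  have hk : Primrec (fun x : (ℕ × ℕ) × ℕ × Bool => x.1.1) := Primrec.fst.comp Primrec.fst
  have ha : Primrec (fun x : (ℕ × ℕ) × ℕ × Bool => x.1.2) := Primrec.snd.comp Primrec.fst
  have hi : Primrec (fun x : (ℕ × ℕ) × ℕ × Bool => x.2.1) := Primrec.fst.comp Primrec.snd
  have hb : Primrec (fun x : (ℕ × ℕ) × ℕ × Bool => x.2.2) := Primrec.snd.comp Primrec.snd
  unfold DD
  refine Primrec.ite (Primrec.eq.comp (Primrec.nat_mod.comp hk (Primrec.const 2))
    (Primrec.const 0)) ?_ ?_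
  · refine Primrec.option_getD.comp (Primrec.option_map (Primrec.list_getElem?.comp
      ((Primrec.ofNat _).comp (Primrec.fst.comp (Primrec.unpair.comp ha))) hi) ?_)
      (Primrec.const false)
    have h1 : Primrec (fun x : ((ℕ × ℕ) × ℕ × Bool) × ℕ =>
        (if x.1.2.2 = true then 0 else 1 : ℕ)) :=
      Primrec.ite (Primrec.eq.comp (hb.comp Primrec.fst) (Primrec.const true))
        (Primrec.const 0) (Primrec.const 1)
    have h2 := (Primrec.not.comp (PrimrecPred.decide (Primrec.eq.comp
      (Primrec.snd (α := (ℕ × ℕ) × ℕ × Bool) (β := ℕ)) h1)))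
    exact h2
  · refine Primrec.and.comp hb ?_
    have hu := Primrec.unpair.comp hi
    refine Primrec.option_isSome.comp (Code.primrec_evaln.comp (Primrec.pair (Primrec.pair
      (Primrec.snd.comp hu) (primrec_trN.comp ha))
      (Primrec₂.natPair.comp (Primrec.fst.comp hu) ha)))

theorem zeroN_zero_one (n e : ℕ) : zeroN n e = 0 ∨ zeroN n e = 1 := by
  cases n with
  | zero => left; rfl
  | succ n =>
    change (if _ then 1 else 0 : ℕ) = 0 ∨ (if _ then 1 else 0 : ℕ) = 1
    split_ifs <;> simp

theorem VV_lower (n : ℕ) : ∀ e, VV DD (2 * n) e ↔ zeroN n e = 0 := by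
  induction n with
  | zero => intro e; simp [VV, zeroN, tjumpIter]
  | succ n ih =>
    intro e
    have hodd : ∀ a, VV DD (2 * n + 1) a ↔
        ∀ q v, (Denumerable.ofNat (List ℕ) a.unpair.1)[q]? = some v → zeroN n q = v := by
      intro a
      simp only [VV]
      rw [not_exists]
      refine forall_congr' fun q => ?_
      have hm : 2 * n % 2 = 0 := by omega
      simp only [DD, hm, if_true]
      have hv : (if decide (VV DD (2 * n) q) = true then 0 else 1 : ℕ) = zeroN n q := by
        simp only [decide_eq_true_eq, ih q]
        rcases zeroN_zero_one n q with h | h <;> simp [h]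
      rw [hv]
      rcases (Denumerable.ofNat (List ℕ) a.unpair.1)[q]? with _ | w
      · simp
      · constructor
        · intro h v hv
          have hv' : w = v := by simpa using hv
          by_contra hne
          apply h
          have : w ≠ zeroN n q := fun h' => hne (by rw [← h', hv'])
          simp [this]
        · intro h h'
          have := h w rfl
          simp [this] at h'
    have hev : VV DD (2 * n + 1 + 1) e ↔ ¬ ((OCode.ofNat e).eval (zeroN n) e).Dom := by
      rw [VV, OCode.dom_iff]
      refine not_congr ?_
      have hm : ¬ ((2 * n + 1) % 2 = 0) := by omega
      simp only [DD, hm, if_false, Bool.and_eq_true, decide_eq_true_eq, hodd]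
      have hdom : ∀ l : List ℕ, ((OCode.ofNat e).evalP (listP l) e).Dom ↔
          ∃ s, (Code.evaln s (trN e) (Nat.pair (Encodable.encode l) e)).isSome = true := by
        intro l
        rw [Part.dom_iff_mem]
        have hc0 : ∀ s n x, x ∈ c0.eval (Nat.pair s n) ↔
            x ∈ listP (Denumerable.ofNat (List ℕ) s) n := Classical.choose_spec exists_lookup_code
        have := OCode.eval_tr hc0 (OCode.ofNat e) (Encodable.encode l) e
        have htr : OCode.tr c0 (OCode.ofNat e) = trN e := rfl
        rw [htr] at this
        rw [Denumerable.ofNat_encode] at this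
        simp only [← this]
        simp only [Code.evaln_complete, Option.isSome_iff_exists, Option.mem_def]
        exact exists_comm
      constructor
      · rintro ⟨i, h1, h2⟩
        refine ⟨_, h1, (hdom _).2 ⟨i.unpair.2, ?_⟩⟩
        rw [Denumerable.encode_ofNat]
        exact h2
      · rintro ⟨l, h1, h2⟩
        obtain ⟨s, hs⟩ := (hdom l).1 h2
        refine ⟨Nat.pair (Encodable.encode l) s, ?_, ?_⟩
        · simpa using h1
        · simpa using hs
    have e1 : 2 * (n + 1) = 2 * n + 1 + 1 := by ring
    rw [e1, hev]
    change _ ↔ (if ((OCode.ofNat e).eval (zeroN n) e).Dom then 1 else 0 : ℕ) = 0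
    split_ifs with h <;> simp [h]

/-! ### Codes of finite sets -/

theorem sort_aux1 (s : Multiset ℕ) (r : ℕ → ℕ → Prop) (d : DecidableRel r) (i1 : IsTrans ℕ r)
    (i2 : Std.Antisymm r) (i3 : Std.Total r) :
    (@Multiset.sort ℕ s r d i1 i2 i3 : Multiset ℕ) = s := Multiset.sort_eq _ _

theorem sort_aux2 (s : Multiset ℕ) (r : ℕ → ℕ → Prop) (d : DecidableRel r) (i1 : IsTrans ℕ r)
    (i2 : Std.Antisymm r) (i3 : Std.Total r) :
    (@Multiset.sort ℕ s r d i1 i2 i3).Pairwise r := Multiset.pairwise_sort _ _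

theorem encode_finset_aux (s : Finset ℕ) : ∃ l : List ℕ, Encodable.encode s = Encodable.encode l ∧
    (l : Multiset ℕ) = s.val ∧ l.Pairwise (fun a b => a ≤ b) := by
  refine ⟨_, rfl, sort_aux1 _ _ _ _ _ _, sort_aux2 _ _ _ _ _ _⟩

theorem encode_finset (l : List ℕ) (hl : l.Pairwise (fun a b => a < b)) :
    Encodable.encode l.toFinset = Encodable.encode l := by
  obtain ⟨m, h1, h2, h3⟩ := encode_finset_aux l.toFinset
  rw [h1]
  congr 1
  have hn : l.Nodup := hl.imp (fun h => ne_of_lt h)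
  have h4 : m.Perm l := by
    rw [← Multiset.coe_eq_coe, h2, List.toFinset_val, hn.dedup]
  exact h4.eq_of_pairwise' h3 (hl.imp le_of_lt)

theorem decode_finset (n : ℕ) : (Encodable.decode (α := Finset ℕ) n).getD ∅ =
    if (Denumerable.ofNat (List ℕ) n).Nodup then (Denumerable.ofNat (List ℕ) n).toFinset
    else ∅ := by
  have h : Encodable.decode (α := Finset ℕ) n =
    if h : (Denumerable.ofNat (List ℕ) n).Nodup then
      some (⟨(Denumerable.ofNat (List ℕ) n : List ℕ), h⟩ : Finset ℕ)
    else none := by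
    change (((Encodable.decode (α := Multiset ℕ) n).bind _).bind _) = _
    have : Encodable.decode (α := Multiset ℕ) n = some ((Denumerable.ofNat (List ℕ) n : List ℕ) : Multiset ℕ) := by
      change Option.map _ (Encodable.decode (α := List ℕ) n) = _
      rw [Denumerable.decode_eq_ofNat]
      rfl
    rw [this, Option.bind_some]
    by_cases h : (Denumerable.ofNat (List ℕ) n).Nodup
    · have h' : ((Denumerable.ofNat (List ℕ) n : List ℕ) : Multiset ℕ).Nodup := h
      rw [dif_pos h', dif_pos h]
      rfl
    · have h' : ¬ ((Denumerable.ofNat (List ℕ) n : List ℕ) : Multiset ℕ).Nodup := h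
      rw [dif_neg h', dif_neg h]
      rfl
  rw [h]
  split_ifs with h
  · ext x
    simp only [Option.getD_some, List.mem_toFinset]
    exact Iff.rfl
  · rfl

/-- Sorted list of the members of a list. -/
def sortL (l : List ℕ) : List ℕ := (List.range (l.foldr (fun a b => a + b) 0 + 1)).filter (fun a => a ∈ l)

theorem mem_sortL {l : List ℕ} {x : ℕ} : x ∈ sortL l ↔ x ∈ l := by
  have h : ∀ (l : List ℕ), x ∈ l → x ≤ l.foldr (fun a b => a + b) 0 := by
    intro l
    induction l with
    | nil => simp
    | cons a l ih =>
      intro h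
      rcases List.mem_cons.1 h with h | h
      · simp [h]
      · have := ih h
        simp only [List.foldr_cons]; omega
  simp only [sortL, List.mem_filter, List.mem_range, decide_eq_true_eq]
  exact ⟨fun h => h.2, fun hx => ⟨Nat.lt_succ_of_le (h l hx), hx⟩⟩

theorem sortL_pairwise (l : List ℕ) : (sortL l).Pairwise (fun a b => a < b) :=
  List.Pairwise.filter _ List.pairwise_lt_range

/-- Normal form of a list representing a finite set. -/
def normL (l : List ℕ) : List ℕ := if (sortL l).length = l.length then sortL l else []

theorem normL_pairwise (l : List ℕ) : (normL l).Pairwise (fun a b => a < b) := by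
  unfold normL; split_ifs
  · exact sortL_pairwise l
  · exact List.Pairwise.nil

theorem decode_finset' (n : ℕ) : (Encodable.decode (α := Finset ℕ) n).getD ∅ =
    (normL (Denumerable.ofNat (List ℕ) n)).toFinset := by
  rw [decode_finset]
  generalize Denumerable.ofNat (List ℕ) n = l
  have e : (sortL l).toFinset = l.toFinset := by ext; simp [mem_sortL]
  have hn : (sortL l).Nodup := (sortL_pairwise l).imp (fun h => ne_of_lt h)
  have h : l.Nodup ↔ (sortL l).length = l.length := by
    rw [← List.toFinset_card_of_nodup hn, e, List.card_toFinset]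
    constructor
    · intro h; rw [h.dedup]
    · intro h
      rw [← (List.dedup_sublist l).eq_of_length h]
      exact List.nodup_dedup l
  unfold normL
  by_cases h' : l.Nodup
  · rw [if_pos h', if_pos (h.1 h'), e]
  · rw [if_neg h', if_neg (fun x => h' (h.2 x))]; rfl

theorem primrec_mem : PrimrecRel (fun (a : ℕ) (l : List ℕ) => a ∈ l) := by
  have h := (PrimrecRel.exists_mem_list (R := fun a b : ℕ => a = b) Primrec.eq)
  have h2 : PrimrecRel (fun (a : ℕ) (l : List ℕ) => ∃ b ∈ l, b = a) :=
    h.comp Primrec.snd Primrec.fst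
  exact h2.of_eq (by simp)

theorem primrec_sortL : Primrec sortL := by
  have hf : Primrec (fun l : List ℕ => l.foldr (fun a b => a + b) 0 + 1) :=
    Primrec.succ.comp (Primrec.list_foldr Primrec.id (Primrec.const 0)
      (Primrec.nat_add.comp (Primrec.fst.comp Primrec.snd) (Primrec.snd.comp Primrec.snd)).to₂)
  exact (PrimrecRel.listFilter primrec_mem).comp (Primrec.list_range.comp hf) Primrec.id

theorem primrec_normL : Primrec normL :=
  Primrec.ite (Primrec.eq.comp (Primrec.list_length.comp primrec_sortL) Primrec.list_length)
    primrec_sortL (Primrec.const [])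

/-! ### The machine -/

/-- Vertex of the node `(k, a)`. -/
def nodeV (k a : ℕ) : ℕ := 2 * Nat.pair k a + 1

/-- Edge colors. -/
def EE (v w : ℕ) : Finset ℕ :=
  if v % 2 = 0 then
    if w = v + 2 then {0}
    else if w % 2 = 1 ∧ (w / 2).unpair.1 = v / 2 then {0} else ∅
  else if w % 2 = 1 ∧ (w / 2).unpair.1 = (v / 2).unpair.1 + 1 then
    if DD (v / 2).unpair.1 (w / 2).unpair.2 (v / 2).unpair.2 true = true then
      if DD (v / 2).unpair.1 (w / 2).unpair.2 (v / 2).unpair.2 false = true then {1, 2} else {1}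
    else
      if DD (v / 2).unpair.1 (w / 2).unpair.2 (v / 2).unpair.2 false = true then {2} else ∅
  else ∅

/-- Labels. -/
def VL (v : ℕ) : ℕ := if v = 0 then 0 else if v % 2 = 0 then 1 else 2

/-- Lookup table. -/
def TT (l : ℕ) (c : Finset ℕ) (z t : ℕ) : Finset ℕ × ℕ × ℕ :=
  if c ⊆ Finset.range 3 ∧ t < 2 then
    if l = 0 then
      if z = 1 ∧ t = 0 then ({0}, 1, 1) else (∅, z, t)
    else if l = 1 then
      if 0 ∈ c ∧ z = 1 then ({0}, z, t) else (∅, z, t)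
    else
      if 0 ∈ c then
        if 1 ∈ c ∨ 2 ∈ c then ({2}, 0, t) else ({1}, 1, t)
      else (∅, z, t)
  else (c, z, t)

theorem EE_sub (v w : ℕ) : EE v w ⊆ Finset.range 3 := by
  unfold EE
  split_ifs <;> decide

/-- The colored graph. -/
def theGraph : ColoredGraph where
  G := Set.univ
  L := {l | l < 3}
  C := {c | c < 3}
  V := VL
  E := EE
  gam := fun _ => Finset.range 3
  V_mem := by
    intro v _
    change VL v < 3
    unfold VL
    split_ifs <;> norm_num
  E_sub := by
    intro v w c hc
    exact Finset.mem_range.1 (EE_sub v w hc)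
  gam_sub := by
    intro l _ c hc
    exact Finset.mem_range.1 hc
  E_allowed := by
    intro v _ w _
    rw [Finset.inter_self]
    exact EE_sub v w

/-- The graph machine. -/
def theM : GraphMachine where
  graph := theGraph
  A := Finset.range 2
  zero_mem := by decide
  one_mem := by decide
  S := {t | t < 2}
  s := 0
  alpha := fun _ => Finset.range 2
  T := TT
  alpha_sub := by
    intro l _ c hc
    exact Finset.mem_range.1 hc
  s_mem := by intro l _; decide
  T_trivial := by
    intro l c z t h
    have h' : ¬ (c ⊆ Finset.range 3 ∧ t < 2) := by
      rintro ⟨h1, h2⟩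
      rcases h with h | h
      · exact h h1
      · exact h (Finset.mem_range.2 h2)
    unfold TT
    rw [if_neg h']
  T_compat := by
    intro l c z t ht hc hz
    have h' : c ⊆ Finset.range 3 ∧ t < 2 := ⟨hc, Finset.mem_range.1 ht⟩
    unfold TT
    rw [if_pos h']
    have e0 : ({0} : Finset ℕ) ⊆ Finset.range 3 := by decide
    have e1 : ({1} : Finset ℕ) ⊆ Finset.range 3 := by decide
    have e2 : ({2} : Finset ℕ) ⊆ Finset.range 3 := by decide
    have z0 : 0 ∈ Finset.range 2 := by decide
    have z1 : 1 ∈ Finset.range 2 := by decide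
    have e3 := Finset.empty_subset (Finset.range 3)
    split_ifs
    · exact ⟨e0, z1, z1⟩
    · exact ⟨e3, hz, ht⟩
    · exact ⟨e0, hz, ht⟩
    · exact ⟨e3, hz, ht⟩
    · exact ⟨e2, z0, ht⟩
    · exact ⟨e1, z1, ht⟩
    · exact ⟨e3, hz, ht⟩
  T_init := by
    intro l
    unfold TT
    simp

/-! ### Computability of the machine -/

theorem primrec_lt_const (n : ℕ) : PrimrecPred (fun x : ℕ => x < n) :=
  Primrec.nat_lt.comp Primrec.id (Primrec.const n)

theorem PrimrecPred.computablePred' {p : ℕ → Prop} (h : PrimrecPred p) : ComputablePred p := by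
  obtain ⟨d, h⟩ := h
  exact ⟨d, h.to_comp⟩

theorem primrec_VL : Primrec VL := by
  unfold VL
  exact Primrec.ite (Primrec.eq.comp Primrec.id (Primrec.const 0)) (Primrec.const 0)
    (Primrec.ite (Primrec.eq.comp (Primrec.nat_mod.comp Primrec.id (Primrec.const 2))
      (Primrec.const 0)) (Primrec.const 1) (Primrec.const 2))

theorem primrec_EE : Primrec (fun p : ℕ × ℕ => Encodable.encode (EE p.1 p.2)) := by
  unfold EE
  simp only [apply_ite (Encodable.encode (α := Finset ℕ))]
  have hv : Primrec (fun p : ℕ × ℕ => p.1) := Primrec.fst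
  have hw : Primrec (fun p : ℕ × ℕ => p.2) := Primrec.snd
  have hv2 : Primrec (fun p : ℕ × ℕ => p.1 / 2) := Primrec.nat_div.comp hv (Primrec.const 2)
  have hw2 : Primrec (fun p : ℕ × ℕ => p.2 / 2) := Primrec.nat_div.comp hw (Primrec.const 2)
  have hvm : Primrec (fun p : ℕ × ℕ => p.1 % 2) := Primrec.nat_mod.comp hv (Primrec.const 2)
  have hwm : Primrec (fun p : ℕ × ℕ => p.2 % 2) := Primrec.nat_mod.comp hw (Primrec.const 2)
  have hvu := Primrec.unpair.comp hv2
  have hwu := Primrec.unpair.comp hw2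
  have hD : ∀ b, PrimrecPred (fun p : ℕ × ℕ =>
      DD (p.1 / 2).unpair.1 (p.2 / 2).unpair.2 (p.1 / 2).unpair.2 b = true) := by
    intro b
    have h : Primrec (fun p : ℕ × ℕ =>
      DD (p.1 / 2).unpair.1 (p.2 / 2).unpair.2 (p.1 / 2).unpair.2 b) :=
      primrec_DD.comp (Primrec.pair
      (Primrec.pair (Primrec.fst.comp hvu) (Primrec.snd.comp hwu))
      (Primrec.pair (Primrec.snd.comp hvu) (Primrec.const b)))
    exact Primrec.eq.comp h (Primrec.const true)
  refine Primrec.ite (Primrec.eq.comp hvm (Primrec.const 0)) ?_ ?_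
  · refine Primrec.ite (Primrec.eq.comp hw (Primrec.nat_add.comp hv (Primrec.const 2)))
      (Primrec.const _) ?_
    exact Primrec.ite (PrimrecPred.and (Primrec.eq.comp hwm (Primrec.const 1))
      (Primrec.eq.comp (Primrec.fst.comp hwu) hv2)) (Primrec.const _) (Primrec.const _)
  · refine Primrec.ite (PrimrecPred.and (Primrec.eq.comp hwm (Primrec.const 1))
      (Primrec.eq.comp (Primrec.fst.comp hwu) (Primrec.succ.comp (Primrec.fst.comp hvu))))
      ?_ (Primrec.const _)
    exact Primrec.ite (hD true)
      (Primrec.ite (hD false) (Primrec.const _) (Primrec.const _))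
      (Primrec.ite (hD false) (Primrec.const _) (Primrec.const _))

theorem primrec_TT : Primrec (fun q : ℕ × ℕ × ℕ × ℕ => Encodable.encode
    (TT q.1 ((Encodable.decode (α := Finset ℕ) q.2.1).getD ∅) q.2.2.1 q.2.2.2)) := by
  simp only [decode_finset']
  have hN : Primrec (fun q : ℕ × ℕ × ℕ × ℕ => normL (Denumerable.ofNat (List ℕ) q.2.1)) :=
    primrec_normL.comp ((Primrec.ofNat _).comp (Primrec.fst.comp Primrec.snd))
  have hl : Primrec (fun q : ℕ × ℕ × ℕ × ℕ => q.1) := Primrec.fst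
  have hz : Primrec (fun q : ℕ × ℕ × ℕ × ℕ => q.2.2.1) :=
    Primrec.fst.comp (Primrec.snd.comp Primrec.snd)
  have ht : Primrec (fun q : ℕ × ℕ × ℕ × ℕ => q.2.2.2) :=
    Primrec.snd.comp (Primrec.snd.comp Primrec.snd)
  have hmem : ∀ i : ℕ, PrimrecPred (fun q : ℕ × ℕ × ℕ × ℕ =>
      i ∈ (normL (Denumerable.ofNat (List ℕ) q.2.1)).toFinset) := by
    intro i
    have := primrec_mem.comp (Primrec.const i) hN
    exact this.of_eq (by simp)
  have hsub : PrimrecPred (fun q : ℕ × ℕ × ℕ × ℕ =>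
      (normL (Denumerable.ofNat (List ℕ) q.2.1)).toFinset ⊆ Finset.range 3) := by
    have := (PrimrecPred.forall_mem_list (primrec_lt_const 3)).comp hN
    exact this.of_eq (by simp [Finset.subset_iff])
  have hc : Primrec (fun q : ℕ × ℕ × ℕ × ℕ =>
      Encodable.encode (normL (Denumerable.ofNat (List ℕ) q.2.1)).toFinset) :=
    (Primrec.encode.comp hN).of_eq (fun q => (encode_finset _ (normL_pairwise _)).symm)
  have hp : ∀ {f : ℕ × ℕ × ℕ × ℕ → Finset ℕ} {g h : ℕ × ℕ × ℕ × ℕ → ℕ},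
      Primrec (fun q => Encodable.encode (f q)) → Primrec g → Primrec h →
      Primrec (fun q => Encodable.encode (f q, g q, h q)) := by
    intro f g h hf hg hh
    exact (Primrec₂.natPair.comp hf (Primrec₂.natPair.comp hg hh))
  unfold TT
  simp only [apply_ite (Encodable.encode (α := Finset ℕ × ℕ × ℕ))]
  have h0 : Primrec (fun q : ℕ × ℕ × ℕ × ℕ =>
      Encodable.encode ((∅ : Finset ℕ), q.2.2.1, q.2.2.2)) := hp (Primrec.const _) hz ht
  refine Primrec.ite (PrimrecPred.and hsub (Primrec.nat_lt.comp ht (Primrec.const 2))) ?_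
    (hp hc hz ht)
  refine Primrec.ite (Primrec.eq.comp hl (Primrec.const 0)) ?_ ?_
  · exact Primrec.ite (PrimrecPred.and (Primrec.eq.comp hz (Primrec.const 1))
      (Primrec.eq.comp ht (Primrec.const 0))) (Primrec.const _) h0
  refine Primrec.ite (Primrec.eq.comp hl (Primrec.const 1)) ?_ ?_
  · exact Primrec.ite (PrimrecPred.and (hmem 0) (Primrec.eq.comp hz (Primrec.const 1)))
      (hp (Primrec.const _) hz ht) h0
  refine Primrec.ite (hmem 0) ?_ h0
  exact Primrec.ite (PrimrecPred.or (hmem 1) (hmem 2))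
    (hp (Primrec.const _) (Primrec.const _) ht) (hp (Primrec.const _) (Primrec.const _) ht)

theorem computablePred_univ : ComputablePred (· ∈ (Set.univ : Set ℕ)) :=
  PrimrecPred.computablePred' ((primrec_lt_const 0).not.of_eq (by simp))

theorem theM_computable : theM.Computable' := by
  refine ⟨⟨computablePred_univ, (primrec_lt_const 3).computablePred',
    (primrec_lt_const 3).computablePred', primrec_VL.to_comp, primrec_EE.to_comp,
    Computable.const _⟩, (primrec_lt_const 2).computablePred', Computable.const _,
    primrec_TT.to_comp⟩

/-! ### Closed form of the run -/

theorem mem_EE_hub {c w k : ℕ} : c ∈ EE w (2 * k) ↔ c = 0 ∧ ∃ j, k = j + 1 ∧ w = 2 * j := by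
  unfold EE
  have h1 : ¬ (2 * k % 2 = 1) := by omega
  simp only [h1, false_and, if_false]
  split_ifs with h2 h3
  · simp only [Finset.mem_singleton]
    exact ⟨fun h => ⟨h, w / 2, by omega, by omega⟩, fun h => h.1⟩
  · simp only [Finset.notMem_empty, false_iff]
    rintro ⟨_, j, hj, hw⟩
    omega
  · simp only [Finset.notMem_empty, false_iff]
    rintro ⟨_, j, hj, hw⟩
    omega

theorem nodeV_mod (k a : ℕ) : nodeV k a % 2 = 1 := by unfold nodeV; omega

theorem nodeV_div (k a : ℕ) : nodeV k a / 2 = Nat.pair k a := by unfold nodeV; omega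

theorem vertex_cases (v : ℕ) : (∃ k, v = 2 * k) ∨ ∃ k a, v = nodeV k a := by
  rcases Nat.mod_two_eq_zero_or_one v with h | h
  · left; exact ⟨v / 2, by omega⟩
  · right
    refine ⟨(v / 2).unpair.1, (v / 2).unpair.2, ?_⟩
    unfold nodeV
    rw [Nat.pair_unpair]; omega

theorem EE_hub_node (j k a : ℕ) : EE (2 * j) (nodeV k a) = if k = j then {0} else ∅ := by
  unfold EE
  have h1 : 2 * j % 2 = 0 := by omega
  have h2 : ¬ (nodeV k a = 2 * j + 2) := by have := nodeV_mod k a; omega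
  have h3 : 2 * j / 2 = j := by omega
  simp only [h1, h2, h3, if_true, if_false, nodeV_mod, nodeV_div, Nat.unpair_pair, true_and]

theorem EE_node_node (j i k a : ℕ) : EE (nodeV j i) (nodeV k a) = if k = j + 1 then
    (if DD j a i true = true then if DD j a i false = true then {1, 2} else {1}
    else if DD j a i false = true then {2} else ∅) else ∅ := by
  unfold EE
  have h1 : ¬ (nodeV j i % 2 = 0) := by have := nodeV_mod j i; omega
  rw [if_neg h1]
  simp only [nodeV_mod, nodeV_div, Nat.unpair_pair, true_and]

theorem mem_pulses {g : Config} {v c : ℕ} :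
    c ∈ theM.pulses g v ↔ ∃ w, c ∈ EE w v ∧ c ∈ (g w).1 := by
  have h : c ∈ theM.pulses g v ↔ c ∈ Finset.range 3 ∧
      ∃ w ∈ (Set.univ : Set ℕ), c ∈ EE w v ∧ c ∈ (g w).1 := Finset.mem_filter
  rw [h]
  constructor
  · rintro ⟨_, w, _, h⟩; exact ⟨w, h⟩
  · rintro ⟨w, h⟩; exact ⟨EE_sub _ _ h.1, w, trivial, h⟩

theorem mem_pulses_hub {g : Config} {k c : ℕ} :
    c ∈ theM.pulses g (2 * k) ↔ c = 0 ∧ ∃ j, k = j + 1 ∧ 0 ∈ (g (2 * j)).1 := by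
  rw [mem_pulses]
  constructor
  · rintro ⟨w, h1, h2⟩
    obtain ⟨rfl, j, rfl, rfl⟩ := mem_EE_hub.1 h1
    exact ⟨rfl, j, rfl, h2⟩
  · rintro ⟨rfl, j, rfl, h2⟩
    exact ⟨2 * j, mem_EE_hub.2 ⟨rfl, j, rfl, rfl⟩, h2⟩

theorem mem_pulses_node0 {g : Config} {k a : ℕ} :
    0 ∈ theM.pulses g (nodeV k a) ↔ 0 ∈ (g (2 * k)).1 := by
  rw [mem_pulses]
  constructor
  · rintro ⟨w, h1, h2⟩
    rcases vertex_cases w with ⟨j, rfl⟩ | ⟨j, i, rfl⟩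
    · rw [EE_hub_node] at h1
      split_ifs at h1 with h
      · rw [h]; exact h2
      · simp at h1
    · rw [EE_node_node] at h1
      split_ifs at h1 <;> simp at h1
  · intro h
    exact ⟨2 * k, by rw [EE_hub_node]; simp, h⟩

theorem mem_pulses_node1 {g : Config} {k a : ℕ} :
    1 ∈ theM.pulses g (nodeV k a) ↔
      ∃ j, k = j + 1 ∧ ∃ i, DD j a i true = true ∧ 1 ∈ (g (nodeV j i)).1 := by
  rw [mem_pulses]
  constructor
  · rintro ⟨w, h1, h2⟩
    rcases vertex_cases w with ⟨j, rfl⟩ | ⟨j, i, rfl⟩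
    · rw [EE_hub_node] at h1
      split_ifs at h1 <;> simp at h1
    · rw [EE_node_node] at h1
      split_ifs at h1 with h3 h4 h5 h6
      · exact ⟨j, h3, i, h4, h2⟩
      · exact ⟨j, h3, i, h4, h2⟩
      all_goals simp at h1
  · rintro ⟨j, rfl, i, h1, h2⟩
    refine ⟨nodeV j i, ?_, h2⟩
    rw [EE_node_node, if_pos rfl, if_pos h1]
    split_ifs <;> simp

theorem mem_pulses_node2 {g : Config} {k a : ℕ} :
    2 ∈ theM.pulses g (nodeV k a) ↔
      ∃ j, k = j + 1 ∧ ∃ i, DD j a i false = true ∧ 2 ∈ (g (nodeV j i)).1 := by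
  rw [mem_pulses]
  constructor
  · rintro ⟨w, h1, h2⟩
    rcases vertex_cases w with ⟨j, rfl⟩ | ⟨j, i, rfl⟩
    · rw [EE_hub_node] at h1
      split_ifs at h1 <;> simp at h1
    · rw [EE_node_node] at h1
      split_ifs at h1 with h3 h4 h5 h6
      · exact ⟨j, h3, i, h5, h2⟩
      · simp at h1
      · exact ⟨j, h3, i, h6, h2⟩
      all_goals simp at h1
  · rintro ⟨j, rfl, i, h1, h2⟩
    refine ⟨nodeV j i, ?_, h2⟩
    rw [EE_node_node, if_pos rfl, if_pos h1]
    split_ifs <;> simp [h1]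

/-- The first hubs are all switched on. -/
def act (x : ℕ → ℕ) (k : ℕ) : Prop := ∀ i ≤ k, x (2 * i) = 1

theorem act_succ {x : ℕ → ℕ} {k : ℕ} : act x (k + 1) ↔ act x k ∧ x (2 * (k + 1)) = 1 := by
  constructor
  · intro h; exact ⟨fun i hi => h i (by omega), h _ le_rfl⟩
  · rintro ⟨h1, h2⟩ i hi
    rcases Nat.lt_or_ge k i with h | h
    · have : i = k + 1 := by omega
      rw [this]; exact h2
    · exact h1 i h

/-- Closed form of the configuration at a hub. -/
def confH (x : ℕ → ℕ) (t k : ℕ) : Finset ℕ × ℕ × ℕ :=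
  (if t = k + 1 ∧ act x k then {0} else ∅, x (2 * k), if k = 0 ∧ 1 ≤ t ∧ x 0 = 1 then 1 else 0)

/-- Closed form of the configuration at a node. -/
def confN (x : ℕ → ℕ) (t k a : ℕ) : Finset ℕ × ℕ × ℕ :=
  (if t = k + 2 ∧ act x k then (if VV DD k a then {1} else {2}) else ∅,
    if k + 2 ≤ t ∧ act x k then (if VV DD k a then 1 else 0) else x (nodeV k a), 0)

theorem pulses_sub (g : Config) (v : ℕ) : theM.pulses g v ⊆ Finset.range 3 :=
  Finset.filter_subset _ _

theorem run_closed (x : ℕ → ℕ) (t : ℕ) :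
    (∀ k, theM.run (theM.start x) t (2 * k) = confH x t k) ∧
    (∀ k a, theM.run (theM.start x) t (nodeV k a) = confN x t k a) := by
  induction t with
  | zero =>
    constructor
    · intro k
      change ((∅ : Finset ℕ), x (2 * k), 0) = _
      simp [confH]
    · intro k a
      change ((∅ : Finset ℕ), x (nodeV k a), 0) = _
      simp [confN]
  | succ t ih =>
    obtain ⟨ihH, ihN⟩ := ih
    set g := theM.run (theM.start x) t with hg
    constructor
    · intro k
      change TT (VL (2 * k)) (theM.pulses g (2 * k)) (g (2 * k)).2.1 (g (2 * k)).2.2 = _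
      have hs : (g (2 * k)).2.2 < 2 := by
        rw [ihH]; simp only [confH]; split_ifs <;> norm_num
      have hc : theM.pulses g (2 * k) ⊆ Finset.range 3 ∧ (g (2 * k)).2.2 < 2 :=
        ⟨pulses_sub _ _, hs⟩
      unfold TT
      rw [if_pos hc]
      rcases k with _ | k
      · have hV : VL (2 * 0) = 0 := by simp [VL]
        rw [if_pos hV, ihH]
        have ha : act x 0 ↔ x 0 = 1 := by simp [act]
        simp only [confH, ha, Nat.mul_zero, true_and]
        by_cases hx : x 0 = 1
        · rcases Nat.eq_zero_or_pos t with rfl | ht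
          · simp [hx]
          · have h1 : t ≠ 0 := by omega
            have h2 : 1 ≤ t := ht
            simp [hx, h1, h2]
        · simp [hx]
      · have hV0 : ¬ (VL (2 * (k + 1)) = 0) := by simp [VL]
        have hV : VL (2 * (k + 1)) = 1 := by simp [VL]
        rw [if_neg hV0, if_pos hV]
        have h0 : 0 ∈ theM.pulses g (2 * (k + 1)) ↔ t = k + 1 ∧ act x k := by
          rw [mem_pulses_hub]
          constructor
          · rintro ⟨_, j, hj, h⟩
            obtain rfl : k = j := by omega
            rw [ihH] at h
            simp only [confH] at h
            split_ifs at h with h'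
            · exact h'
            · simp at h
          · intro h
            refine ⟨rfl, k, rfl, ?_⟩
            rw [ihH]
            simp [confH, h.1, h.2]
        simp only [h0]
        rw [ihH]
        simp only [confH, act_succ, Nat.add_right_cancel_iff, and_assoc]
        simp
        split_ifs <;> rfl
    · intro k a
      change TT (VL (nodeV k a)) (theM.pulses g (nodeV k a)) (g (nodeV k a)).2.1
        (g (nodeV k a)).2.2 = _
      have hs : (g (nodeV k a)).2.2 < 2 := by
        rw [ihN]; simp only [confN]; norm_num
      have hc : theM.pulses g (nodeV k a) ⊆ Finset.range 3 ∧ (g (nodeV k a)).2.2 < 2 :=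
        ⟨pulses_sub _ _, hs⟩
      have hm := nodeV_mod k a
      have hz : nodeV k a ≠ 0 := by omega
      have hm0 : ¬ (nodeV k a % 2 = 0) := by omega
      have hV : VL (nodeV k a) = 2 := by unfold VL; rw [if_neg hz, if_neg hm0]
      unfold TT
      rw [if_pos hc, hV, if_neg (by norm_num), if_neg (by norm_num)]
      have h0 : 0 ∈ theM.pulses g (nodeV k a) ↔ t = k + 1 ∧ act x k := by
        rw [mem_pulses_node0, ihH]
        simp only [confH]
        split_ifs with h <;> simp [h]
      by_cases h : t = k + 1 ∧ act x k
      · rw [if_pos (h0.2 h)]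
        have hv : (1 ∈ theM.pulses g (nodeV k a) ∨ 2 ∈ theM.pulses g (nodeV k a)) ↔
            ¬ VV DD k a := by
          rw [mem_pulses_node1, mem_pulses_node2]
          rcases k with _ | k
          · simp [VV]
          · have ht : t = k + 2 ∧ act x k := ⟨h.1, (act_succ.1 h.2).1⟩
            have g1 : ∀ i, 1 ∈ (g (nodeV k i)).1 ↔ VV DD k i := by
              intro i
              rw [ihN]; simp only [confN]; rw [if_pos ht]
              split_ifs with h <;> simp [h]
            have g2 : ∀ i, 2 ∈ (g (nodeV k i)).1 ↔ ¬ VV DD k i := by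
              intro i
              rw [ihN]; simp only [confN]; rw [if_pos ht]
              split_ifs with h <;> simp [h]
            simp only [VV, not_not]
            constructor
            · rintro (⟨j, hj, i, h1, h2⟩ | ⟨j, hj, i, h1, h2⟩)
              · obtain rfl : k = j := by omega
                rw [g1] at h2
                exact ⟨i, by simpa [h2] using h1⟩
              · obtain rfl : k = j := by omega
                rw [g2] at h2
                exact ⟨i, by simpa [h2] using h1⟩
            · rintro ⟨i, hi⟩
              by_cases h2 : VV DD k i
              · left; exact ⟨k, rfl, i, by simpa [h2] using hi, (g1 i).2 h2⟩
              · right; exact ⟨k, rfl, i, by simpa [h2] using hi, (g2 i).2 h2⟩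
        have ht1 : t + 1 = k + 2 ∧ act x k := ⟨by omega, h.2⟩
        have ht2 : k + 2 ≤ t + 1 ∧ act x k := ⟨by omega, h.2⟩
        rw [ihN]
        simp only [confN, hv]
        rw [if_pos ht1, if_pos ht2]
        by_cases h3 : VV DD k a <;> simp [h3]
      · rw [if_neg (fun h' => h (h0.1 h')), ihN]
        have ht1 : ¬ (t + 1 = k + 2 ∧ act x k) := fun h' => h ⟨by omega, h'.2⟩
        have ht2 : (k + 2 ≤ t + 1 ∧ act x k) ↔ (k + 2 ≤ t ∧ act x k) := by
          constructor
          · rintro ⟨h1, h2⟩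
            refine ⟨?_, h2⟩
            have : t ≠ k + 1 := fun h' => h ⟨h', h2⟩
            omega
          · rintro ⟨h1, h2⟩; exact ⟨by omega, h2⟩
        simp only [confN]
        rw [if_neg ht1]
        simp only [ht2]

/-! ### Halting and output -/

theorem exists_hub_zero {x : ℕ → ℕ} (hx : {v | x v ≠ 0}.Finite) : ∃ N, x (2 * N) = 0 := by
  by_contra h
  push Not at h
  have hsub : Set.range (fun n : ℕ => 2 * n) ⊆ {v | x v ≠ 0} := by
    rintro _ ⟨n, rfl⟩; exact h n
  exact Set.infinite_range_of_injective (f := fun n : ℕ => 2 * n)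
    (fun a b h => by simpa using h) (hx.subset hsub)

theorem haltsAt_of {x : ℕ → ℕ} {N : ℕ} (hN : x (2 * N) = 0) :
    theM.HaltsAt (theM.start x) (N + 2) := by
  intro v _
  have hact : ∀ k, act x k → k < N := by
    intro k hk
    by_contra h
    have := hk N (by omega)
    omega
  rcases vertex_cases v with ⟨k, rfl⟩ | ⟨k, a, rfl⟩
  · rw [(run_closed x _).1, (run_closed x _).1]
    have h1 : ¬ (N + 2 + 1 = k + 1 ∧ act x k) := by
      rintro ⟨h, h'⟩; have := hact k h'; omega
    have h2 : ¬ (N + 2 = k + 1 ∧ act x k) := by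
      rintro ⟨h, h'⟩; have := hact k h'; omega
    have h3 : 1 ≤ N + 2 + 1 := by omega
    have h4 : 1 ≤ N + 2 := by omega
    simp only [confH, if_neg h1, if_neg h2, h3, h4]
  · rw [(run_closed x _).2, (run_closed x _).2]
    have h1 : ¬ (N + 2 + 1 = k + 2 ∧ act x k) := by
      rintro ⟨h, h'⟩; have := hact k h'; omega
    have h2 : ¬ (N + 2 = k + 2 ∧ act x k) := by
      rintro ⟨h, h'⟩; have := hact k h'; omega
    have h3 : (k + 2 ≤ N + 2 + 1 ∧ act x k) ↔ (k + 2 ≤ N + 2 ∧ act x k) := by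
      constructor
      · rintro ⟨_, h'⟩; have := hact k h'; exact ⟨by omega, h'⟩
      · rintro ⟨_, h'⟩; have := hact k h'; exact ⟨by omega, h'⟩
    simp only [confN, if_neg h1, if_neg h2, h3]

theorem output_eq {x : ℕ → ℕ} (hx : {v | x v ≠ 0}.Finite) (v t₀ : ℕ) :
    ∃ t ≥ t₀, theM.outputAt x v = (theM.run (theM.start x) t v).2.1 := by
  obtain ⟨N, hN⟩ := exists_hub_zero hx
  have hne : {n | theM.HaltsAt (theM.start x) n}.Nonempty := ⟨N + 2, haltsAt_of hN⟩
  have hm := Nat.sInf_mem hne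
  set n0 := sInf {n | theM.HaltsAt (theM.start x) n} with hn0
  have hstep : theM.run (theM.start x) (n0 + 1) = theM.run (theM.start x) n0 := by
    funext v
    exact hm v trivial
  have hconst : ∀ m, theM.run (theM.start x) (n0 + m) = theM.run (theM.start x) n0 := by
    intro m
    induction m with
    | zero => rfl
    | succ m ih =>
      change theM.step (theM.run (theM.start x) (n0 + m)) = _
      rw [ih]
      exact hstep
  refine ⟨n0 + t₀, by omega, ?_⟩
  rw [hconst]
  rfl

theorem output_hub {x : ℕ → ℕ} (hx : {v | x v ≠ 0}.Finite) (k : ℕ) :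
    theM.outputAt x (2 * k) = x (2 * k) := by
  obtain ⟨t, _, h⟩ := output_eq hx (2 * k) 0
  rw [h, (run_closed x t).1]
  rfl

theorem output_node {x : ℕ → ℕ} (hx : {v | x v ≠ 0}.Finite) (k a : ℕ) :
    theM.outputAt x (nodeV k a) =
      if act x k then (if VV DD k a then 1 else 0) else x (nodeV k a) := by
  obtain ⟨t, ht, h⟩ := output_eq hx (nodeV k a) (k + 2)
  rw [h, (run_closed x t).2]
  have : (k + 2 ≤ t ∧ act x k) ↔ act x k := ⟨fun h => h.2, fun h => ⟨ht, h⟩⟩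
  simp only [confN, this]

theorem restrictTo_univ (x : ℕ → ℕ) : restrictTo Set.univ x = x := by
  funext v; simp [restrictTo]

theorem theM_computes : GraphComputableVia theM Set.univ theM.outputAt := by
  refine ⟨theM_computable, Set.infinite_univ, computablePred_univ, fun _ _ => trivial,
    ?_, ?_, ?_, ?_⟩
  · intro x hx
    obtain ⟨N, hN⟩ := exists_hub_zero hx.2.2
    exact ⟨_, haltsAt_of hN⟩
  · intro x y _ _ h v _
    rw [restrictTo_univ, restrictTo_univ] at h
    rw [h]
  · intro x _ v _ hv
    exact absurd trivial hv
  · intro x _ v _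
    rw [restrictTo_univ]

theorem decodeFS_finite (n : ℕ) : {v | decodeFS n v ≠ 0}.Finite := by
  refine (Set.finite_lt_nat (Denumerable.ofNat (List ℕ) n).length).subset ?_
  intro v hv
  by_contra h
  apply hv
  unfold decodeFS
  rw [List.getD_eq_default]
  simpa using h

/-- The function on codes. -/
def zf : ℕ → ℕ := zetaFn theM Set.univ theM.outputAt

theorem zf_eq (p : ℕ) : zf p =
    if ∀ a ∈ Denumerable.ofNat (List ℕ) p.unpair.1, a < 2 then
      theM.outputAt (decodeFS p.unpair.1) p.unpair.2 else 0 := by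
  have h : ((∀ v ∈ (Set.univ : Set ℕ), decodeFS p.unpair.1 v ∈ theM.A) ∧
      (∀ v ∉ (Set.univ : Set ℕ), decodeFS p.unpair.1 v = 0) ∧
      p.unpair.2 ∈ (Set.univ : Set ℕ)) ↔
      ∀ a ∈ Denumerable.ofNat (List ℕ) p.unpair.1, a < 2 := by
    constructor
    · rintro ⟨h, _⟩ a ha
      obtain ⟨i, hi, rfl⟩ := List.mem_iff_getElem.1 ha
      have := Finset.mem_range.1 (h i trivial)
      unfold decodeFS at this
      rwa [List.getD_eq_getElem _ _ hi] at this
    · intro h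
      refine ⟨fun v _ => Finset.mem_range.2 ?_, fun v hv => absurd trivial hv, trivial⟩
      unfold decodeFS
      by_cases hv : v < (Denumerable.ofNat (List ℕ) p.unpair.1).length
      · rw [List.getD_eq_getElem _ _ hv]
        exact h _ (List.getElem_mem hv)
      · rw [List.getD_eq_default _ _ (by omega)]
        norm_num
  unfold zf zetaFn
  simp only [h]

/-- The queried vertex is a node in an active level. -/
def actP (p : ℕ) : Prop :=
  p.unpair.2 % 2 = 1 ∧ ∀ i ∈ List.range ((p.unpair.2 / 2).unpair.1 + 1),
    (Denumerable.ofNat (List ℕ) p.unpair.1).getD (2 * i) 0 = 1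

theorem zf_le : TuringLE zf zeroOmega := by
  obtain ⟨d, hd⟩ := VV_upper (D := DD) primrec_DD.to_comp
  have hv : Primrec (fun p : ℕ => p.unpair.2) := Primrec.snd.comp Primrec.unpair
  have hl : Primrec (fun p : ℕ => Denumerable.ofNat (List ℕ) p.unpair.1) :=
    (Primrec.ofNat _).comp (Primrec.fst.comp Primrec.unpair)
  have hu : Primrec (fun p : ℕ => (p.unpair.2 / 2).unpair) :=
    Primrec.unpair.comp (Primrec.nat_div.comp hv (Primrec.const 2))
  have hq : Primrec (fun p : ℕ => Nat.pair (p.unpair.2 / 2).unpair.1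
      (gfun d (p.unpair.2 / 2).unpair.1 (p.unpair.2 / 2).unpair.2)) :=
    Primrec₂.natPair.comp (Primrec.fst.comp hu) (primrec_gfun.comp (Primrec.pair
      (Primrec.const d) hu))
  have hgood : PrimrecPred (fun p : ℕ =>
      ∀ a ∈ Denumerable.ofNat (List ℕ) p.unpair.1, a < 2) :=
    (PrimrecPred.forall_mem_list (primrec_lt_const 2)).comp hl
  have hR : PrimrecRel (fun (i : ℕ) (l : List ℕ) => l.getD (2 * i) 0 = 1) :=
    Primrec.eq.comp ((Primrec.list_getD 0).comp Primrec.snd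
      (Primrec.nat_mul.comp (Primrec.const 2) Primrec.fst)) (Primrec.const 1)
  have hact : PrimrecPred (fun p : ℕ => ∀ i ∈ List.range ((p.unpair.2 / 2).unpair.1 + 1),
      (Denumerable.ofNat (List ℕ) p.unpair.1).getD (2 * i) 0 = 1) :=
    (PrimrecRel.forall_mem_list hR).comp
      (Primrec.list_range.comp (Primrec.succ.comp (Primrec.fst.comp hu))) hl
  have hodd : PrimrecPred (fun p : ℕ => p.unpair.2 % 2 = 1) :=
    Primrec.eq.comp (Primrec.nat_mod.comp hv (Primrec.const 2)) (Primrec.const 1)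
  have hactP : PrimrecPred actP := PrimrecPred.and hodd hact
  have hh : Primrec₂ (fun p r : ℕ =>
      if ∀ a ∈ Denumerable.ofNat (List ℕ) p.unpair.1, a < 2 then
        (if actP p then
          (if r = 0 then 1 else 0)
        else (Denumerable.ofNat (List ℕ) p.unpair.1).getD p.unpair.2 0) else 0 : ℕ → ℕ → ℕ) := by
    refine Primrec.ite (hgood.comp Primrec.fst) ?_ (Primrec.const 0)
    refine Primrec.ite (hactP.comp Primrec.fst) ?_ ?_
    · exact Primrec.ite (Primrec.eq.comp Primrec.snd (Primrec.const 0)) (Primrec.const 1)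
        (Primrec.const 0)
    · exact ((Primrec.list_getD 0).comp hl hv).comp Primrec.fst
  refine TuringLE.of_query hq.to_comp hh.to_comp ?_
  intro p
  rw [zf_eq]
  by_cases h1 : ∀ a ∈ Denumerable.ofNat (List ℕ) p.unpair.1, a < 2
  · rw [if_pos h1, if_pos h1]
    rcases vertex_cases p.unpair.2 with ⟨k, hk⟩ | ⟨k, a, hk⟩
    · have h2 : ¬ actP p := by
        rintro ⟨h, _⟩; omega
      rw [if_neg h2, hk, output_hub (decodeFS_finite _)]
      rfl
    · have hact' : actP p ↔ act (decodeFS p.unpair.1) k := by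
        unfold actP act
        rw [hk, nodeV_mod, nodeV_div, Nat.unpair_pair]
        simp only [true_and, List.mem_range, Nat.lt_succ_iff]
        rfl
      rw [hk, output_node (decodeFS_finite _), nodeV_div, Nat.unpair_pair]
      have hz : zeroOmega (Nat.pair k (gfun d k a)) = zeroN k (gfun d k a) := by
        unfold zeroOmega omegaIter
        rw [Nat.unpair_pair]
        rfl
      simp only [hact', hz, hd]
      rfl
  · rw [if_neg h1, if_neg h1]

theorem zf_node (k a : ℕ) :
    zf (Nat.pair (Encodable.encode (List.replicate (2 * k + 1) 1)) (nodeV k a)) =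
      if VV DD k a then 1 else 0 := by
  rw [zf_eq]
  have hdec : ∀ v, v < 2 * k + 1 →
      decodeFS (Encodable.encode (List.replicate (2 * k + 1) 1)) v = 1 := by
    intro v hv
    unfold decodeFS
    rw [Denumerable.ofNat_encode, List.getD_eq_getElem _ _ (by simpa using hv)]
    simp
  rw [Nat.unpair_pair]
  rw [if_pos, output_node (decodeFS_finite _), if_pos]
  · intro i hi
    exact hdec _ (by omega)
  · intro a ha
    rw [Denumerable.ofNat_encode] at ha
    rw [List.eq_of_mem_replicate ha]
    norm_num

theorem le_zf : TuringLE zeroOmega zf := by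
  have hq : Primrec (fun p : ℕ => Nat.pair (Encodable.encode
      (List.replicate (2 * (2 * p.unpair.1) + 1) 1)) (nodeV (2 * p.unpair.1) p.unpair.2)) := by
    have h1 : Primrec (fun p : ℕ => 2 * p.unpair.1) :=
      Primrec.nat_mul.comp (Primrec.const 2) (Primrec.fst.comp Primrec.unpair)
    have h2 : Primrec (fun p : ℕ => 2 * (2 * p.unpair.1) + 1) :=
      Primrec.succ.comp (Primrec.nat_mul.comp (Primrec.const 2) h1)
    have h3 : Primrec (fun n : ℕ => List.replicate n 1) :=
      (Primrec.list_map Primrec.list_range (Primrec.const 1).to₂).of_eq (fun n => by simp)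
    refine Primrec₂.natPair.comp (Primrec.encode.comp (h3.comp h2)) ?_
    exact Primrec.succ.comp (Primrec.nat_mul.comp (Primrec.const 2)
      (Primrec₂.natPair.comp h1 (Primrec.snd.comp Primrec.unpair)))
  have hh : Primrec₂ (fun _ r : ℕ => 1 - r) :=
    Primrec.nat_sub.comp (Primrec.const 1) Primrec.snd
  refine TuringLE.of_query hq.to_comp hh.to_comp ?_
  intro p
  rw [zf_node]
  change zeroN p.unpair.1 p.unpair.2 = _
  simp only [VV_lower]
  rcases zeroN_zero_one p.unpair.1 p.unpair.2 with h | h <;> simp [h]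

/-- There is a graph computable function, computed via a computable
graph machine whose underlying colored graph is finitary, that is Turing equivalent
to `𝟎^(ω)`. -/
theorem stmt10 :
    ∃ (M : GraphMachine) (X : Set ℕ) (ζ : (ℕ → ℕ) → ℕ → ℕ),
      GraphComputableVia M X ζ ∧ M.graph.Finitary ∧
      TuringEq (zetaFn M X ζ) zeroOmega := by
  refine ⟨theM, Set.univ, theM.outputAt, theM_computes, ?_, zf_le, le_zf⟩
  exact Set.finite_lt_nat 3

end
end

section
/- Let 𝔐 be a computable graph machine whose underlying computable colored graph 𝒢 has finite degree, and suppose {𝔐} is total. Then {𝔐} is computable from the degree function deg_𝒢, and the range of {𝔐} is contained in 𝔄^{<G} (i.e., every output displays 0 on all but finitely many vertices). -/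
open scoped Classical
noncomputable section

/-! ### Oracle computability helpers -/

namespace S15

theorem tle_of_nat_partrec {f : ℕ → ℕ} (O : ℕ → ℕ) (hf : Nat.Partrec (f : ℕ →. ℕ)) :
    TuringLE f O := by
  obtain ⟨c, hc⟩ := Nat.Partrec.Code.exists_code.1 hf
  have key : ∀ c : Nat.Partrec.Code, ∃ d : OCode, d.eval O = c.eval := by
    intro c
    induction c with
    | zero => exact ⟨.zero, rfl⟩
    | succ => exact ⟨.succ, rfl⟩
    | left => exact ⟨.left, rfl⟩
    | right => exact ⟨.right, rfl⟩
    | pair a b iha ihb =>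
      obtain ⟨d, hd⟩ := iha
      obtain ⟨e, he⟩ := ihb
      exact ⟨.pair d e, by simp only [OCode.eval, Nat.Partrec.Code.eval, hd, he]; rfl⟩
    | comp a b iha ihb =>
      obtain ⟨d, hd⟩ := iha
      obtain ⟨e, he⟩ := ihb
      exact ⟨.comp d e, by simp only [OCode.eval, Nat.Partrec.Code.eval, hd, he]; rfl⟩
    | prec a b iha ihb =>
      obtain ⟨d, hd⟩ := iha
      obtain ⟨e, he⟩ := ihb
      exact ⟨.prec d e, by simp only [OCode.eval, Nat.Partrec.Code.eval, hd, he]; rfl⟩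
    | rfind' a iha =>
      obtain ⟨d, hd⟩ := iha
      exact ⟨.rfind' d, by simp only [OCode.eval, Nat.Partrec.Code.eval, hd]; rfl⟩
  obtain ⟨d, hd⟩ := key c
  exact ⟨d, fun n => by rw [hd, hc]; rfl⟩

theorem tle_of_computable {f : ℕ → ℕ} (O : ℕ → ℕ) (hf : Computable f) : TuringLE f O :=
  tle_of_nat_partrec O (Partrec.nat_iff.1 hf)

theorem tle_comp {f g O : ℕ → ℕ} (hf : TuringLE f O) (hg : TuringLE g O) :
    TuringLE (fun n => f (g n)) O := by
  obtain ⟨c, hc⟩ := hf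
  obtain ⟨d, hd⟩ := hg
  refine ⟨.comp c d, fun n => ?_⟩
  simp only [OCode.eval, hd]
  exact (Part.bind_some _ _).trans (hc _)

theorem tle_pair {f g O : ℕ → ℕ} (hf : TuringLE f O) (hg : TuringLE g O) :
    TuringLE (fun n => Nat.pair (f n) (g n)) O := by
  obtain ⟨c, hc⟩ := hf
  obtain ⟨d, hd⟩ := hg
  refine ⟨.pair c d, fun n => ?_⟩
  simp [OCode.eval, hc, hd, Seq.seq]

theorem tle_oracle (O : ℕ → ℕ) : TuringLE O O := ⟨.oracle, fun _ => rfl⟩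

/-- Code of the initial segment of the oracle. -/
def pre (O : ℕ → ℕ) (k : ℕ) : List ℕ := (List.range k).map O

theorem tle_pre (O : ℕ → ℕ) : TuringLE (fun k => Encodable.encode (pre O k)) O := by
  have h1 : Computable (fun z : ℕ => Encodable.encode
      (Denumerable.ofNat (List ℕ) z.unpair.1 ++ [z.unpair.2])) := by
    refine Computable.encode.comp (Computable.list_concat.comp ?_ ?_)
    · exact (Computable.ofNat (List ℕ)).comp (Computable.fst.comp Computable.unpair)
    · exact Computable.snd.comp Computable.unpair
  have hr : Computable (fun z : ℕ => z.unpair.2) := Computable.snd.comp Computable.unpair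
  have hl : Computable (fun z : ℕ => z.unpair.1) := Computable.fst.comp Computable.unpair
  have h2 : TuringLE (fun z => (fun z : ℕ => Encodable.encode
      (Denumerable.ofNat (List ℕ) z.unpair.1 ++ [z.unpair.2]))
      (Nat.pair (z.unpair.2.unpair.2) (O (z.unpair.2.unpair.1)))) O :=
    tle_comp (tle_of_computable O h1) (tle_pair (tle_of_computable O (hr.comp hr))
      (tle_comp (tle_oracle O) (tle_of_computable O (hl.comp hr))))
  obtain ⟨c, hc⟩ := h2
  have h3 : TuringLE (fun z => Encodable.encode (pre O z.unpair.2)) O := by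
    refine ⟨.prec .zero c, fun z => ?_⟩
    simp only [OCode.eval, Nat.unpaired]
    generalize z.unpair.2 = k
    induction k with
    | zero => rfl
    | succ k ih =>
      simp only at ih ⊢
      rw [ih]
      simp [hc, pre, List.range_succ]
  have := tle_comp h3 (tle_of_computable O (f := fun k => Nat.pair 0 k)
    (Primrec₂.natPair.to_comp.comp (Computable.const 0) Computable.id))
  simpa using this

/-- Reduction by searching through finite initial segments of the oracle. -/
theorem tle_of_search (f O : ℕ → ℕ) (F : ℕ × List ℕ × ℕ → ℕ) (hF : Computable F)
    (hs : ∀ p k n y, F (p, pre O k, n) = y + 1 → y = f p)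
    (hc : ∀ p, ∃ k n, F (p, pre O k, n) ≠ 0) : TuringLE f O := by
  have hr : Computable (fun z : ℕ => z.unpair.2) := Computable.snd.comp Computable.unpair
  have hl : Computable (fun z : ℕ => z.unpair.1) := Computable.fst.comp Computable.unpair
  let F' : ℕ → ℕ := fun z =>
    F (z.unpair.1.unpair.1, Denumerable.ofNat (List ℕ) z.unpair.2, z.unpair.1.unpair.2.unpair.2)
  have hF' : Computable F' := hF.comp (Computable.pair (hl.comp hl)
    (Computable.pair ((Computable.ofNat (List ℕ)).comp hr) (hr.comp (hr.comp hl))))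
  let H : ℕ → ℕ := fun z => F (z.unpair.1, pre O z.unpair.2.unpair.1, z.unpair.2.unpair.2)
  have hH : TuringLE H O := by
    have := tle_comp (tle_of_computable O hF') (tle_pair (tle_of_computable O Computable.id)
      (tle_comp (tle_pre O) (tle_of_computable O (hl.comp hr))))
    simpa [F', H] using this
  have hT : TuringLE (fun z => 1 - H z) O :=
    tle_comp (tle_of_computable O (f := fun y => 1 - y)
      (Primrec.nat_sub.to_comp.comp (Computable.const 1) Computable.id)) hH
  obtain ⟨c, hcT⟩ := hT
  have hex : ∀ p, ∃ t, 1 - H (Nat.pair p t) = 0 := by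
    intro p
    obtain ⟨k, n, h⟩ := hc p
    exact ⟨Nat.pair k n, by simp [H]; omega⟩
  let t : ℕ → ℕ := fun p => Nat.find (hex p)
  have ht : TuringLE (fun z => t z) O := by
    have hp : Computable (fun p : ℕ => Nat.pair p 0) :=
      Primrec₂.natPair.to_comp.comp Computable.id (Computable.const 0)
    obtain ⟨d, hd⟩ := tle_of_computable O hp
    refine ⟨.comp (.rfind' c) d, fun p => ?_⟩
    simp only [OCode.eval, hd, hcT]
    simp only [Part.bind_eq_bind, Part.bind_some, Nat.unpaired, Nat.unpair_pair, Nat.add_zero]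
    rw [Part.eq_some_iff]
    simp only [Part.map_eq_map, Part.map_some, Part.mem_map_iff]
    refine ⟨t p, Nat.mem_rfind.2 ⟨?_, ?_⟩, rfl⟩
    · have := Nat.find_spec (hex p)
      simpa [t] using this
    · intro m hm
      have := Nat.find_min (hex p) hm
      simpa using this
  have hfin := tle_comp (tle_of_computable O (f := fun y => y - 1)
      (Primrec.nat_sub.to_comp.comp Computable.id (Computable.const 1)))
      (tle_comp hH (tle_pair (tle_of_computable O Computable.id) ht))
  have heq : (fun p => H (Nat.pair (id p) (t p)) - 1) = f := by
    funext p
    have h0 : 1 - H (Nat.pair p (t p)) = 0 := Nat.find_spec (hex p)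
    obtain ⟨y, hy⟩ : ∃ y, H (Nat.pair p (t p)) = y + 1 := ⟨H (Nat.pair p (t p)) - 1, by omega⟩
    have := hs p _ _ y (by simpa [H] using hy)
    simp [hy, this]
  rw [← heq]
  exact hfin

/-! ### Computable list operations -/

section lists
variable {α β σ : Type} [Primcodable α] [Primcodable β] [Primcodable σ]

theorem c_foldl {f : α → List β} {g : α → σ} {h : α → σ × β → σ} (hf : Computable f)
    (hg : Computable g) (hh : Computable₂ h) :
    Computable fun a => (f a).foldl (fun s b => h a (s, b)) (g a) := by
  have hstep : Computable₂ (fun (a : α) (q : ℕ × σ) =>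
      (((f a)[q.1]?).map (fun b => h a (q.2, b))).getD q.2) := by
    refine Computable.option_getD (Computable.option_map ?_ ?_) ?_
    · exact Computable.list_getElem?.comp (hf.comp Computable.fst)
        (Computable.fst.comp Computable.snd)
    · exact hh.comp (Computable.fst.comp Computable.fst) (Computable.pair
        (Computable.snd.comp (Computable.snd.comp Computable.fst)) Computable.snd)
    · exact Computable.snd.comp Computable.snd
  refine (Computable.nat_rec (Computable.list_length.comp hf) hg hstep).of_eq fun a => ?_
  have : ∀ n, (Nat.rec (motive := fun _ => σ) (g a) (fun y IH =>
      (((f a)[y]?).map (fun b => h a (IH, b))).getD IH) n : σ) =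
      ((f a).take n).foldl (fun s b => h a (s, b)) (g a) := by
    intro n
    induction n with
    | zero => simp
    | succ n ih =>
      rw [List.take_add_one, List.foldl_append, ← ih]
      simp only
      cases (f a)[n]? <;> simp
  simpa using this (f a).length

theorem c_map {f : α → List β} {g : α → β → σ} (hf : Computable f) (hg : Computable₂ g) :
    Computable fun a => (f a).map (g a) := by
  refine (c_foldl (h := fun a (q : List σ × β) => q.1 ++ [g a q.2]) hf (Computable.const [])
    ?_).of_eq fun a => ?_
  · exact Computable.list_concat.comp (Computable.fst.comp Computable.snd)
      (hg.comp Computable.fst (Computable.snd.comp Computable.snd))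
  · have : ∀ (l : List β) (acc : List σ),
      l.foldl (fun s b => s ++ [g a b]) acc = acc ++ l.map (g a) := by
      intro l
      induction l with
      | nil => simp
      | cons b l ih => intro acc; simp [ih]
    simpa using this (f a) []

theorem c_filter {f : α → List β} {p : α → β → Bool} (hf : Computable f) (hp : Computable₂ p) :
    Computable fun a => (f a).filter (p a) := by
  refine (c_foldl (h := fun a (q : List β × β) => bif p a q.2 then q.1 ++ [q.2] else q.1) hf
    (Computable.const []) ?_).of_eq fun a => ?_
  · exact Computable.cond (hp.comp Computable.fst (Computable.snd.comp Computable.snd))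
      (Computable.list_concat.comp (Computable.fst.comp Computable.snd)
        (Computable.snd.comp Computable.snd)) (Computable.fst.comp Computable.snd)
  · have : ∀ (l acc : List β),
      l.foldl (fun s b => bif p a b then s ++ [b] else s) acc = acc ++ l.filter (p a) := by
      intro l
      induction l with
      | nil => simp
      | cons b l ih => intro acc; cases h : p a b <;> simp [ih, h]
    simpa using this (f a) []

theorem c_and {p q : α → Bool} (hp : Computable p) (hq : Computable q) :
    Computable fun a => (p a && q a) :=
  (Computable.cond hp hq (Computable.const false)).of_eq fun a => by cases p a <;> rfl

theorem c_or {p q : α → Bool} (hp : Computable p) (hq : Computable q) :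
    Computable fun a => (p a || q a) :=
  (Computable.cond hp (Computable.const true) hq).of_eq fun a => by cases p a <;> rfl

theorem c_not {p : α → Bool} (hp : Computable p) : Computable fun a => !(p a) :=
  (Computable.cond hp (Computable.const false) (Computable.const true)).of_eq
    fun a => by cases p a <;> rfl

theorem c_any {f : α → List β} {p : α → β → Bool} (hf : Computable f) (hp : Computable₂ p) :
    Computable fun a => (f a).any (p a) := by
  refine (c_foldl (h := fun a (q : Bool × β) => q.1 || p a q.2) hf (Computable.const false)
    ?_).of_eq fun a => ?_
  · exact c_or (Computable.fst.comp Computable.snd)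
      (hp.comp Computable.fst (Computable.snd.comp Computable.snd))
  · have : ∀ (l : List β) (acc : Bool),
      l.foldl (fun s b => s || p a b) acc = (acc || l.any (p a)) := by
      intro l
      induction l with
      | nil => simp
      | cons b l ih => intro acc; simp [ih, Bool.or_assoc]
    simpa using this (f a) false

theorem c_all {f : α → List β} {p : α → β → Bool} (hf : Computable f) (hp : Computable₂ p) :
    Computable fun a => (f a).all (p a) := by
  refine (c_not (c_any hf (c_not hp).to₂)).of_eq fun a => ?_
  simp [List.any_eq_not_all_not]

theorem c_eq [DecidableEq β] {f g : α → β} (hf : Computable f) (hg : Computable g) :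
    Computable fun a => decide (f a = g a) :=
  ((Primrec.beq (α := β)).to_comp.comp hf hg).of_eq fun a => by simp [beq_eq_decide]

end lists

end S15

/-! ### Semantics of runs -/

namespace S15

variable {M : GraphMachine}

theorem pulses_congr {g h : Config} (H : ∀ v ∈ M.graph.G, g v = h v) (v : ℕ) :
    M.pulses g v = M.pulses h v := by
  ext c
  simp only [GraphMachine.pulses, Finset.mem_filter]
  refine and_congr_right fun _ => exists_congr fun w => and_congr_right fun hw => ?_
  rw [H w hw]

theorem step_congr {g h : Config} (H : ∀ v ∈ M.graph.G, g v = h v) :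
    ∀ v ∈ M.graph.G, M.step g v = M.step h v := by
  intro v hv
  simp only [GraphMachine.step, pulses_congr H, H v hv]

theorem halts_stable {f : Config} {n : ℕ} (h : M.HaltsAt f n) :
    ∀ j, ∀ v ∈ M.graph.G, M.run f (n + j) v = M.run f n v := by
  intro j
  induction j with
  | zero => intro v _; rfl
  | succ j ih =>
    intro v hv
    have := step_congr ih v hv
    exact this.trans (h v hv)

theorem output_eq {x : ℕ → ℕ} {n : ℕ} (h : M.HaltsAt (M.start x) n) {v : ℕ}
    (hv : v ∈ M.graph.G) : M.outputAt x v = (M.run (M.start x) n v).2.1 := by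
  have h0 : M.HaltsAt (M.start x) (sInf {n | M.HaltsAt (M.start x) n}) :=
    Nat.sInf_mem (s := {n | M.HaltsAt (M.start x) n}) ⟨n, h⟩
  have hle : sInf {n | M.HaltsAt (M.start x) n} ≤ n := Nat.sInf_le h
  obtain ⟨j, hj⟩ := Nat.exists_eq_add_of_le hle
  have := halts_stable h0 j v hv
  rw [← hj] at this
  rw [this]
  rfl

theorem run_valid {x : ℕ → ℕ} (hx : M.InDom x) (n : ℕ) :
    ∀ v ∈ M.graph.G, (M.run (M.start x) n v).2.1 ∈ M.A ∧
      (M.run (M.start x) n v).2.2 ∈ M.alpha (M.graph.V v) := by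
  induction n with
  | zero => intro v hv; exact ⟨hx.1 v hv, M.s_mem _ (M.graph.V_mem v hv)⟩
  | succ n ih =>
    intro v hv
    have := M.T_compat (M.graph.V v) (M.pulses (M.run (M.start x) n) v) _ _ (ih v hv).2
      (Finset.filter_subset _ _) (ih v hv).1
    exact this.2

/-- If no neighbour sends a pulse, a trivial vertex stays trivial. -/
theorem step_trivial {g : Config} {v : ℕ} (hv : g v = (∅, 0, M.s))
    (h : ∀ w ∈ M.graph.G, M.graph.E w v ≠ ∅ → (g w).1 = ∅) : M.step g v = (∅, 0, M.s) := by
  have hp : M.pulses g v = ∅ := by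
    rw [GraphMachine.pulses, Finset.filter_eq_empty_iff]
    rintro c - ⟨w, hw, h1, h2⟩
    rw [h w hw (Finset.ne_empty_of_mem h1)] at h2
    simp at h2
  simp only [GraphMachine.step, hp, hv, M.T_init]

theorem active_finite (hfd : M.graph.FiniteDegree) {x : ℕ → ℕ} (hx : M.InDom x) (n : ℕ) :
    {v ∈ M.graph.G | M.run (M.start x) n v ≠ (∅, 0, M.s)}.Finite := by
  induction n with
  | zero =>
    refine hx.2.2.subset ?_
    rintro v ⟨-, hv⟩ h0
    exact hv (by simp [GraphMachine.run, GraphMachine.start, h0])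
  | succ n ih =>
    refine (ih.union (ih.biUnion (t := fun w => M.graph.degSet w)
      fun w hw => hfd w hw.1)).subset ?_
    rintro v ⟨hv, hne⟩
    by_contra hcon
    simp only [Set.mem_union, Set.mem_ofPred_eq, Set.mem_iUnion, not_or, not_and, not_not,
      not_exists] at hcon
    refine hne (step_trivial (hcon.1 hv) fun w hw hE => ?_)
    by_contra hp
    refine hcon.2 w ⟨hw, fun h => hp (by rw [h])⟩ ⟨hv, Or.inl hE⟩

/-- The machine truncated to vertices below `k`. -/
abbrev trunc (M : GraphMachine) (k : ℕ) : GraphMachine := M.restrict (Set.Iio k)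

theorem trunc_step {k : ℕ} {g h : Config} (heq : ∀ v ∈ M.graph.G, v < k → g v = h v)
    (hp : ∀ v ∈ M.graph.G, k ≤ v → (g v).1 = ∅) :
    ∀ v ∈ M.graph.G, v < k → M.step g v = (trunc M k).step h v := by
  intro v hv hk
  have : M.pulses g v = (trunc M k).pulses h v := by
    ext c
    simp only [GraphMachine.pulses, Finset.mem_filter]
    refine and_congr_right fun _ => exists_congr fun w => ?_
    constructor
    · rintro ⟨hw, h1, h2⟩
      have hwk : w < k := by
        by_contra hwk
        rw [hp w hw (not_lt.1 hwk)] at h2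
        simp at h2
      exact ⟨⟨hw, hwk⟩, h1, heq w hw hwk ▸ h2⟩
    · rintro ⟨⟨hw, hwk⟩, h1, h2⟩
      exact ⟨hw, h1, by rw [heq w hw hwk]; exact h2⟩
  simp only [GraphMachine.step, this, heq v hv hk]
  rfl

theorem trunc_run {k n : ℕ} {f : Config}
    (hp : ∀ m < n, ∀ v ∈ M.graph.G, k ≤ v → (M.run f m v).1 = ∅) :
    ∀ m ≤ n, ∀ v ∈ M.graph.G, v < k → M.run f m v = (trunc M k).run f m v := by
  intro m
  induction m with
  | zero => intros; rfl
  | succ m ih =>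
    intro hm
    exact trunc_step (ih (by omega)) (hp m (by omega))

/-- Soundness of the saturation test. -/
theorem trunc_sound {k n : ℕ} {x : ℕ → ℕ} (hx : ∀ v, k ≤ v → x v = 0)
    (hsat : ∀ m ≤ n, ∀ v ∈ M.graph.G, v < k → ((trunc M k).run (M.start x) m v).1 ≠ ∅ →
      ∀ w ∈ M.graph.degSet v, w < k) :
    ∀ m ≤ n + 1, ∀ v ∈ M.graph.G,
      (v < k → M.run (M.start x) m v = (trunc M k).run (M.start x) m v) ∧
      (k ≤ v → M.run (M.start x) m v = (∅, 0, M.s)) := by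
  intro m
  induction m with
  | zero =>
    intro _ v _
    refine ⟨fun _ => rfl, fun h => ?_⟩
    simp [GraphMachine.run, GraphMachine.start, hx v h]
  | succ m ih =>
    intro hm
    have ih := ih (by omega)
    have h1 := trunc_step (M := M) (k := k) (fun v hv hk => (ih v hv).1 hk)
      (fun v hv hk => by rw [(ih v hv).2 hk])
    refine fun v hv => ⟨fun hk => h1 v hv hk, fun hk => ?_⟩
    refine step_trivial ((ih v hv).2 hk) fun w hw hE => ?_
    by_contra hne
    by_cases hwk : w < k
    · rw [(ih w hw).1 hwk] at hne
      have := hsat m (by omega) w hw hwk hne v ⟨hv, Or.inl hE⟩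
      omega
    · rw [(ih w hw).2 (not_lt.1 hwk)] at hne
      exact hne rfl

theorem trunc_complete (hfd : M.graph.FiniteDegree) {x : ℕ → ℕ} (hx : M.InDom x) (n b : ℕ) :
    ∃ k, b ≤ k ∧ (∀ m ≤ n + 1, ∀ v ∈ M.graph.G, v < k →
        M.run (M.start x) m v = (trunc M k).run (M.start x) m v) ∧
      ∀ m ≤ n, ∀ v ∈ M.graph.G, v < k → ((trunc M k).run (M.start x) m v).1 ≠ ∅ →
        ∀ w ∈ M.graph.degSet v, w < k := by
  let A : Set ℕ := ⋃ m ∈ Set.Iic n, {v ∈ M.graph.G | M.run (M.start x) m v ≠ (∅, 0, M.s)}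
  have hA : A.Finite := (Set.finite_Iic n).biUnion fun m _ => active_finite hfd hx m
  have hAG : ∀ v ∈ A, v ∈ M.graph.G := by
    intro v hv
    simp only [A, Set.mem_iUnion] at hv
    obtain ⟨m, _, h⟩ := hv
    exact h.1
  have hmem : ∀ m ≤ n, ∀ v ∈ M.graph.G, (M.run (M.start x) m v).1 ≠ ∅ → v ∈ A := by
    intro m hm v hv hne
    simp only [A, Set.mem_iUnion]
    exact ⟨m, hm, hv, fun h => hne (by rw [h])⟩
  have hB : (A ∪ ⋃ v ∈ A, M.graph.degSet v).Finite :=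
    hA.union (hA.biUnion fun v hv => hfd v (hAG v hv))
  obtain ⟨c, hc⟩ := hB.bddAbove
  have hc1 : ∀ v ∈ A, v ≤ c := fun v hv => hc (Or.inl hv)
  have hc2 : ∀ v ∈ A, ∀ w ∈ M.graph.degSet v, w ≤ c := fun v hv w hw =>
    hc (Or.inr (Set.mem_biUnion hv hw))
  refine ⟨max b (c + 1), le_max_left _ _, ?_⟩
  have hrun : ∀ m ≤ n + 1, ∀ v ∈ M.graph.G, v < max b (c + 1) →
      M.run (M.start x) m v = (trunc M (max b (c + 1))).run (M.start x) m v := by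
    refine trunc_run fun m hm v hv hk => ?_
    by_contra hne
    have := hc1 v (hmem m (by omega) v hv hne)
    have := le_max_right b (c + 1)
    omega
  refine ⟨hrun, fun m hm v hv hk hne w hw => ?_⟩
  rw [← hrun m (by omega) v hv hk] at hne
  have := hc2 v (hmem m hm v hv hne) w hw
  have := le_max_right b (c + 1)
  omega

end S15

/-! ### Effective simulation -/

namespace S15

/-- The canonical list of a finite set (read off from its code). -/
def lst (s : Finset ℕ) : List ℕ := Denumerable.ofNat (List ℕ) (Encodable.encode s)

theorem decode_finset (n : ℕ) : Encodable.decode (α := Finset ℕ) n =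
    if h : (Denumerable.ofNat (List ℕ) n).Nodup then
      some ⟨(Denumerable.ofNat (List ℕ) n : Multiset ℕ), h⟩ else none := by
  have h1 : Encodable.decode (α := Multiset ℕ) n =
      some (Denumerable.ofNat (List ℕ) n : Multiset ℕ) := by
    change ((↑) : List ℕ → Multiset ℕ) <$> Encodable.decode (α := List ℕ) n = _
    rw [Denumerable.decode_eq_ofNat]
    rfl
  have h2 : ∀ inst : DecidablePred (Multiset.Nodup : Multiset ℕ → Prop),
      (@Subtype.encodable _ _ _ inst).decode n =
      if h : (Denumerable.ofNat (List ℕ) n).Nodup then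
        some ⟨(Denumerable.ofNat (List ℕ) n : Multiset ℕ), h⟩ else none := by
    intro inst
    change (Encodable.decode (α := Multiset ℕ) n).bind _ = _
    rw [h1]
    simp only [Option.bind_some, Multiset.coe_nodup]
  refine (@Encodable.decode_ofEquiv _ _ (_) _ n).trans ?_
  rw [h2]
  split_ifs <;> rfl

theorem lst_spec (s : Finset ℕ) : (lst s).Nodup ∧ ∀ c, c ∈ lst s ↔ c ∈ s := by
  have h := Encodable.encodek s
  rw [decode_finset] at h
  split_ifs at h with hn
  refine ⟨hn, fun c => ?_⟩
  have h' := Option.some.inj h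
  conv_rhs => rw [← h']
  simp [lst, ← Finset.mem_val]

theorem lst_inj {s t : Finset ℕ} (h : lst s = lst t) : s = t := by
  ext c
  rw [← (lst_spec s).2, h, (lst_spec t).2]

theorem lst_eq_nil {s : Finset ℕ} : lst s = [] ↔ s = ∅ := by
  rw [List.eq_nil_iff_forall_not_mem, Finset.eq_empty_iff_forall_notMem]
  simp only [(lst_spec s).2]

theorem decode_list {l : List ℕ} (h : l.Nodup) :
    (Encodable.decode (α := Finset ℕ) (Encodable.encode l)).getD ∅ = l.toFinset := by
  rw [decode_finset]
  simp only [Denumerable.ofNat_encode, h, dif_pos, Option.getD_some]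
  ext c
  simp [← Finset.mem_val]

/-- Cells of the simulated configuration. -/
abbrev Cell := List ℕ × ℕ × ℕ

def toCell (q : Finset ℕ × ℕ × ℕ) : Cell := (lst q.1, q.2.1, q.2.2)

theorem toCell_inj {q r : Finset ℕ × ℕ × ℕ} (h : toCell q = toCell r) : q = r := by
  obtain ⟨a, b, c⟩ := q
  obtain ⟨a', b', c'⟩ := r
  simp only [toCell, Prod.mk.injEq] at h ⊢
  exact ⟨lst_inj h.1, h.2⟩

variable (M : GraphMachine)

def gB (v : ℕ) : Bool := decide (v ∈ M.graph.G)

def fT (q : ℕ × List ℕ × ℕ × ℕ) : Cell :=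
  toCell (M.T q.1 ((Encodable.decode (α := Finset ℕ) (Encodable.encode q.2.1)).getD ∅)
    q.2.2.1 q.2.2.2)

/-- the cell of a vertex in a simulated configuration -/
def cell (cfg : List Cell) (v : ℕ) : Cell := cfg.getD v ([], 0, 0)

def sends (q : List Cell × ℕ × ℕ) (w : ℕ) : Bool :=
  gB M w && ((lst (M.graph.E w q.2.1)).any (fun c => decide (c = q.2.2)) &&
    (cell q.1 w).1.any (fun c => decide (c = q.2.2)))

def plist (k : ℕ) (cfg : List Cell) (v : ℕ) : List ℕ :=
  (lst (M.graph.gam (M.graph.V v))).filter fun c => (List.range k).any (sends M (cfg, v, c))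

def cstep (k : ℕ) (cfg : List Cell) (v : ℕ) : Cell :=
  fT M (M.graph.V v, plist M k cfg v, (cell cfg v).2.1, (cell cfg v).2.2)

def crun (k : ℕ) (x : List ℕ) (n : ℕ) : List Cell :=
  Nat.rec ((List.range k).map fun v => (([], x.getD v 0, M.s) : Cell))
    (fun _ cfg => (List.range k).map (cstep M k cfg)) n

theorem cell_map (k : ℕ) (f : ℕ → Cell) {v : ℕ} (hv : v < k) :
    cell ((List.range k).map f) v = f v := by
  simp [cell, List.getD, hv]

theorem crun_spec (k : ℕ) (x : List ℕ) (n : ℕ) : ∀ v < k,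
    cell (crun M k x n) v = toCell ((trunc M k).run (M.start (fun v => x.getD v 0)) n v) := by
  induction n with
  | zero =>
    intro v hv
    have h0 : crun M k x 0 = (List.range k).map fun v => (([], x.getD v 0, M.s) : Cell) := rfl
    rw [h0, cell_map k _ hv]
    simp [toCell, GraphMachine.run, GraphMachine.start, lst_eq_nil.2]
  | succ n ih =>
    intro v hv
    have h0 : crun M k x (n + 1) = (List.range k).map (cstep M k (crun M k x n)) := rfl
    rw [h0, cell_map k _ hv]
    have hp : (plist M k (crun M k x n) v).toFinset =
        (trunc M k).pulses ((trunc M k).run (M.start (fun v => x.getD v 0)) n) v := by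
      ext c
      simp only [plist, List.mem_toFinset, List.mem_filter, GraphMachine.pulses,
        Finset.mem_filter, (lst_spec _).2, List.any_eq_true, List.mem_range, sends,
        Bool.and_eq_true, decide_eq_true_eq, gB]
      refine and_congr_right fun _ => exists_congr fun w => ?_
      constructor
      · rintro ⟨hw, hG, ⟨c1, h1, rfl⟩, ⟨c2, h2, rfl⟩⟩
        rw [ih w hw] at h2
        exact ⟨⟨hG, hw⟩, h1, (lst_spec _).2 _ |>.1 h2⟩
      · rintro ⟨⟨hG, hw⟩, h1, h2⟩
        refine ⟨hw, hG, ⟨c, h1, rfl⟩, ⟨c, ?_, rfl⟩⟩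
        rw [ih w hw]
        exact ((lst_spec _).2 _).2 h2
    have hn : (plist M k (crun M k x n) v).Nodup := (lst_spec _).1.filter _
    simp only [cstep, fT]
    rw [decode_list hn, hp, ih v hv]
    rfl

def adjB (v w : ℕ) : Bool :=
  gB M w && (!decide (lst (M.graph.E v w) = []) || !decide (lst (M.graph.E w v) = []))

/-- all neighbours of `v` are below `σ.length`, tested with `σ` -/
def satB (σ : List ℕ) (v : ℕ) : Bool :=
  decide (((List.range σ.length).filter (adjB M v)).length = σ.getD v 0)

theorem satB_spec (hfd : M.graph.FiniteDegree) {k v : ℕ} (hv : v ∈ M.graph.G) (hk : v < k) :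
    satB M (pre M.graph.degFun k) v = true ↔ ∀ w ∈ M.graph.degSet v, w < k := by
  have h1 : (pre M.graph.degFun k).getD v 0 = (M.graph.degSet v).ncard := by
    simp [pre, List.getD, hk, ColoredGraph.degFun, hv]
  have h2 : (pre M.graph.degFun k).length = k := by simp [pre]
  have h3 : ((List.range k).filter (adjB M v)).length =
      (M.graph.degSet v ∩ Set.Iio k).ncard := by
    rw [← List.toFinset_card_of_nodup (List.nodup_range.filter _), ← Set.ncard_coe_finset]
    congr 1
    ext w
    simp only [ColoredGraph.degSet, List.coe_toFinset]
    simp [adjB, gB, lst_eq_nil]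
    tauto
  simp only [satB, decide_eq_true_eq, h1, h2, h3]
  constructor
  · intro h w hw
    have := Set.eq_of_subset_of_ncard_le (Set.inter_subset_left (t := Set.Iio k)) h.ge (hfd v hv)
    rw [← this] at hw
    exact hw.2
  · intro h
    congr 1
    exact Set.inter_eq_left.2 h

def haltB (k : ℕ) (x : List ℕ) (n v : ℕ) : Bool :=
  !(gB M v) || decide (cell (crun M k x (n + 1)) v = cell (crun M k x n) v)

def satOK (σ x : List ℕ) (m v : ℕ) : Bool :=
  !(gB M v) || (decide ((cell (crun M σ.length x m) v).1 = []) || satB M σ v)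

def chk (x σ : List ℕ) (n : ℕ) : Bool :=
  (List.range σ.length).all (haltB M σ.length x n) &&
    (List.range (n + 1)).all (fun m => (List.range σ.length).all (satOK M σ x m))

theorem chk_spec (hfd : M.graph.FiniteDegree) (x : List ℕ) (k n : ℕ) :
    chk M x (pre M.graph.degFun k) n = true ↔
      (∀ v ∈ M.graph.G, v < k → (trunc M k).run (M.start (fun v => x.getD v 0)) (n + 1) v =
        (trunc M k).run (M.start (fun v => x.getD v 0)) n v) ∧
      ∀ m ≤ n, ∀ v ∈ M.graph.G, v < k →
        ((trunc M k).run (M.start (fun v => x.getD v 0)) m v).1 ≠ ∅ →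
        ∀ w ∈ M.graph.degSet v, w < k := by
  have h2 : (pre M.graph.degFun k).length = k := by simp [pre]
  simp only [chk, h2, Bool.and_eq_true, List.all_eq_true, List.mem_range, haltB, satOK,
    Bool.or_eq_true, Bool.not_eq_true', gB, decide_eq_false_iff_not, decide_eq_true_eq]
  refine and_congr ?_ ?_
  · refine forall_congr' fun v => ?_
    constructor
    · intro h hv hk
      have := (h hk).resolve_left (not_not.2 hv)
      rw [crun_spec M k x _ v hk, crun_spec M k x _ v hk] at this
      exact toCell_inj this
    · intro h hk
      by_cases hv : v ∈ M.graph.G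
      · right
        rw [crun_spec M k x _ v hk, crun_spec M k x _ v hk, h hv hk]
      · exact Or.inl hv
  · refine forall_congr' fun m => ?_
    rw [Nat.lt_succ_iff]
    refine forall_congr' fun _ => forall_congr' fun v => ?_
    constructor
    · intro h hv hk hne
      rcases (h hk).resolve_left (not_not.2 hv) with h | h
      · rw [crun_spec M k x _ v hk] at h
        exact absurd (lst_eq_nil.1 h) hne
      · exact (satB_spec M hfd hv hk).1 h
    · intro h hk
      by_cases hv : v ∈ M.graph.G
      · right
        by_cases hne : ((trunc M k).run (M.start (fun v => x.getD v 0)) m v).1 = ∅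
        · left
          rw [crun_spec M k x _ v hk]
          exact lst_eq_nil.2 hne
        · exact Or.inr ((satB_spec M hfd hv hk).2 (h hv hk hne))
      · exact Or.inl hv

def domB (x : List ℕ) (v : ℕ) : Bool :=
  bif gB M v then M.A.toList.any (fun z => decide (z = x.getD v 0)) else decide (x.getD v 0 = 0)

def goodB (x : List ℕ) : Bool := (List.range x.length).all (domB M x)

theorem goodB_spec (x : List ℕ) : goodB M x = true ↔ M.InDom (fun v => x.getD v 0) := by
  have hz : ∀ v, x.length ≤ v → x.getD v 0 = 0 := fun v hv => by simp [List.getD, hv]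
  simp only [goodB, domB, List.all_eq_true, List.mem_range, GraphMachine.InDom]
  constructor
  · intro h
    refine ⟨fun v hv => ?_, fun v hv => ?_, ?_⟩
    · by_cases hl : v < x.length
      · have := h v hl
        simp only [gB, hv, decide_true, cond_true, List.any_eq_true, decide_eq_true_eq] at this
        obtain ⟨z, h1, h2⟩ := this
        rw [← h2]
        simpa using h1
      · rw [hz v (not_lt.1 hl)]
        exact M.zero_mem
    · by_cases hl : v < x.length
      · have := h v hl
        simpa only [gB, hv, decide_false, cond_false, decide_eq_true_eq] using this
      · exact hz v (not_lt.1 hl)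
    · refine (Set.finite_Iio x.length).subset fun v hv => ?_
      by_contra hl
      exact hv (hz v (not_lt.1 hl))
  · rintro ⟨h1, h2, -⟩ v -
    by_cases hv : v ∈ M.graph.G
    · simp only [gB, hv, decide_true, cond_true, List.any_eq_true, decide_eq_true_eq]
      exact ⟨_, by simpa using h1 v hv, rfl⟩
    · simpa only [gB, hv, decide_false, cond_false, decide_eq_true_eq] using h2 v hv

/-- The search function, with unpacked arguments. -/
def srchAux (x : List ℕ) (v : ℕ) (σ : List ℕ) (n : ℕ) : ℕ :=
  bif goodB M x && gB M v then
    bif (decide (x.length - σ.length = 0) && decide (v + 1 - σ.length = 0)) && chk M x σ n then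
      (cell (crun M σ.length x n) v).2.1 + 1
    else 0
  else 1

/-- The search function. -/
def srch (q : ℕ × List ℕ × ℕ) : ℕ :=
  srchAux M (Denumerable.ofNat (List ℕ) q.1.unpair.1) q.1.unpair.2 q.2.1 q.2.2

theorem srch_sound (hfd : M.graph.FiniteDegree) (p k n y : ℕ)
    (h : srch M (p, pre M.graph.degFun k, n) = y + 1) : y = M.fn p := by
  have h2 : (pre M.graph.degFun k).length = k := by simp [pre]
  simp only [srch, srchAux, h2] at h
  rw [GraphMachine.fn]
  have hx : decodeFS p.unpair.1 = fun v => (Denumerable.ofNat (List ℕ) p.unpair.1).getD v 0 := rfl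
  rw [hx]
  generalize Denumerable.ofNat (List ℕ) p.unpair.1 = x at *
  generalize p.unpair.2 = v at *
  cases hg : (goodB M x && gB M v) with
  | false =>
    rw [hg, cond_false] at h
    have : ¬ (M.InDom (fun v => x.getD v 0) ∧ M.Halts (M.start (fun v => x.getD v 0)) ∧
      v ∈ M.graph.G) := by
      rintro ⟨h1, -, h3⟩
      rw [(goodB_spec M x).2 h1] at hg
      simp [gB, h3] at hg
    rw [if_neg this]
    omega
  | true =>
    rw [hg, cond_true] at h
    simp only [Bool.and_eq_true, goodB_spec, gB, decide_eq_true_eq] at hg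
    cases hc : ((decide (x.length - k = 0) && decide (v + 1 - k = 0)) &&
        chk M x (pre M.graph.degFun k) n) with
    | false => rw [hc, cond_false] at h; omega
    | true =>
      rw [hc, cond_true] at h
      simp only [Bool.and_eq_true, decide_eq_true_eq, chk_spec M hfd] at hc
      obtain ⟨⟨hl, hv⟩, hh, hs⟩ := hc
      have hvk : v < k := by omega
      have hS := trunc_sound (M := M) (k := k) (n := n) (x := fun v => x.getD v 0)
        (fun v hv => by
          have : x.length ≤ v := by omega
          simp [List.getD, this]) hs
      have hH : M.HaltsAt (M.start (fun v => x.getD v 0)) n := by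
        intro w hw
        by_cases hwk : w < k
        · rw [(hS _ le_rfl w hw).1 hwk, (hS n (by omega) w hw).1 hwk]
          exact hh w hw hwk
        · rw [(hS _ le_rfl w hw).2 (not_lt.1 hwk), (hS n (by omega) w hw).2 (not_lt.1 hwk)]
      rw [if_pos ⟨hg.1, ⟨n, hH⟩, hg.2⟩, output_eq hH hg.2, (hS n (by omega) v hg.2).1 hvk]
      rw [crun_spec M k x _ v hvk] at h
      simp only [toCell] at h
      omega

theorem srch_complete (hfd : M.graph.FiniteDegree) (hT : M.Total) (p : ℕ) :
    ∃ k n, srch M (p, pre M.graph.degFun k, n) ≠ 0 := by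
  simp only [srch]
  generalize Denumerable.ofNat (List ℕ) p.unpair.1 = x at *
  generalize p.unpair.2 = v at *
  simp only [srchAux]
  cases hg : (goodB M x && gB M v) with
  | false => exact ⟨0, 0, by simp⟩
  | true =>
    simp only [Bool.and_eq_true, goodB_spec, gB, decide_eq_true_eq] at hg
    obtain ⟨n, hn⟩ := hT _ hg.1
    obtain ⟨k, hk, h1, h2⟩ := trunc_complete hfd hg.1 n (max x.length (v + 1))
    refine ⟨k, n, ?_⟩
    have hlen : (pre M.graph.degFun k).length = k := by simp [pre]
    have hc : chk M x (pre M.graph.degFun k) n = true := by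
      rw [chk_spec M hfd]
      refine ⟨fun v hv hk => ?_, h2⟩
      rw [← h1 _ le_rfl v hv hk, ← h1 n (by omega) v hv hk]
      exact hn v hv
    have e1 : x.length - k = 0 := by omega
    have e2 : v + 1 - k = 0 := by omega
    simp [hlen, hc, e1, e2]

end S15

namespace S15

section comp
open Computable

variable {M : GraphMachine} {α : Type} [Primcodable α]

theorem c_gB (hM : M.Computable') : Computable (gB M) := by
  obtain ⟨inst, h⟩ := hM.1.1
  refine h.of_eq fun v => ?_
  simp only [gB]
  congr

theorem c_V (hM : M.Computable') : Computable M.graph.V := hM.1.2.2.2.1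

theorem c_E (hM : M.Computable') : Computable₂ (fun v w => lst (M.graph.E v w)) :=
  (Computable.ofNat (List ℕ)).comp hM.1.2.2.2.2.1

theorem c_gam (hM : M.Computable') : Computable (fun l => lst (M.graph.gam l)) :=
  (Computable.ofNat (List ℕ)).comp hM.1.2.2.2.2.2

theorem c_fT_aux {F : ℕ × ℕ × ℕ × ℕ → ℕ} (h0 : Computable F) :
    Computable (fun q : ℕ × List ℕ × ℕ × ℕ =>
      ((Denumerable.ofNat (List ℕ) (F (q.1, Encodable.encode q.2.1, q.2.2)).unpair.1,
        (F (q.1, Encodable.encode q.2.1, q.2.2)).unpair.2.unpair.1,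
        (F (q.1, Encodable.encode q.2.1, q.2.2)).unpair.2.unpair.2) : Cell)) := by
  have h1 : Computable (fun q : ℕ × List ℕ × ℕ × ℕ => (q.1, Encodable.encode q.2.1, q.2.2)) :=
    fst.pair ((Computable.encode.comp (fst.comp snd)).pair (snd.comp snd))
  have h := h0.comp h1
  have hr : Computable (fun z : ℕ => z.unpair.2) := Computable.snd.comp Computable.unpair
  have hl : Computable (fun z : ℕ => z.unpair.1) := Computable.fst.comp Computable.unpair
  exact ((Computable.ofNat (List ℕ)).comp (hl.comp h)).pair
    ((hl.comp (hr.comp h)).pair (hr.comp (hr.comp h)))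

theorem c_fT (hM : M.Computable') : Computable (fT M) := by
  refine (c_fT_aux hM.2.2.2).of_eq fun q => ?_
  simp only [fT, toCell, lst]
  generalize M.T q.1 _ _ _ = r
  obtain ⟨a, b, c⟩ := r
  simp [Encodable.encode_prod_val]

theorem c_cell : Computable₂ cell := (Primrec.list_getD (([], 0, 0) : Cell)).to_comp

theorem c_range {f : α → ℕ} (hf : Computable f) : Computable fun a => List.range (f a) :=
  Primrec.list_range.to_comp.comp hf

theorem c_getD {f : α → List ℕ} {g : α → ℕ} (hf : Computable f) (hg : Computable g) :
    Computable fun a => (f a).getD (g a) 0 :=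
  (Primrec.list_getD (0 : ℕ)).to_comp.comp hf hg

theorem c_sub {f g : α → ℕ} (hf : Computable f) (hg : Computable g) :
    Computable fun a => f a - g a := Primrec.nat_sub.to_comp.comp hf hg

theorem c_mem {f : α → List ℕ} {g : α → ℕ} (hf : Computable f) (hg : Computable g) :
    Computable fun a => (f a).any (fun c => decide (c = g a)) :=
  c_any hf (c_eq snd (hg.comp fst)).to₂

theorem c_sends (hM : M.Computable') : Computable₂ (sends M) := by
  refine c_and ((c_gB hM).comp snd) (c_and (c_mem ?_ ?_) (c_mem ?_ ?_))
  · exact (c_E hM).comp snd (fst.comp (snd.comp fst))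
  · exact snd.comp (snd.comp fst)
  · exact fst.comp (c_cell.comp (fst.comp fst) snd)
  · exact snd.comp (snd.comp fst)

theorem c_plist (hM : M.Computable') :
    Computable (fun q : ℕ × List Cell × ℕ => plist M q.1 q.2.1 q.2.2) := by
  have h2 : Computable₂ (fun (p : (ℕ × List Cell × ℕ) × ℕ) (w : ℕ) =>
      sends M (p.1.2.1, p.1.2.2, p.2) w) :=
    (c_sends hM).comp (Computable.pair (fst.comp (snd.comp (fst.comp fst)))
      (Computable.pair (snd.comp (snd.comp (fst.comp fst))) (snd.comp fst))) snd
  have h1 : Computable₂ (fun (q : ℕ × List Cell × ℕ) (c : ℕ) =>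
      (List.range q.1).any (sends M (q.2.1, q.2.2, c))) :=
    c_any (c_range (fst.comp fst)) h2
  exact c_filter ((c_gam hM).comp ((c_V hM).comp (snd.comp snd))) h1

theorem c_cstep (hM : M.Computable') :
    Computable (fun q : ℕ × List Cell × ℕ => cstep M q.1 q.2.1 q.2.2) := by
  have hc : Computable (fun q : ℕ × List Cell × ℕ => cell q.2.1 q.2.2) :=
    c_cell.comp (fst.comp snd) (snd.comp snd)
  exact (c_fT hM).comp (((c_V hM).comp (snd.comp snd)).pair ((c_plist hM).pair
    ((fst.comp (snd.comp hc)).pair (snd.comp (snd.comp hc)))))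

theorem c_crun_aux {S : ℕ → List Cell → ℕ → Cell} {I : List ℕ → ℕ → Cell}
    (hS : Computable (fun q : ℕ × List Cell × ℕ => S q.1 q.2.1 q.2.2))
    (hI : Computable₂ I) {k n : α → ℕ} {x : α → List ℕ} (hk : Computable k)
    (hx : Computable x) (hn : Computable n) :
    Computable (fun a => (Nat.rec ((List.range (k a)).map (I (x a)))
      (fun _ cfg => (List.range (k a)).map (S (k a) cfg)) (n a) : List Cell)) := by
  have h0 : Computable₂ (fun (a : α) (v : ℕ) => I (x a) v) := hI.comp (hx.comp fst) snd
  have h1 : Computable₂ (fun (p : α × ℕ × List Cell) (v : ℕ) => S (k p.1) p.2.2 v) :=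
    hS.comp ((hk.comp (fst.comp fst)).pair ((snd.comp (snd.comp fst)).pair snd))
  have h2 : Computable₂ (fun (a : α) (q : ℕ × List Cell) =>
      (List.range (k a)).map (S (k a) q.2)) :=
    c_map (c_range (hk.comp fst)) h1
  exact Computable.nat_rec hn (c_map (c_range hk) h0) h2

theorem c_init (s : ℕ) :
    Computable₂ (fun (x : List ℕ) (v : ℕ) => (([], x.getD v 0, s) : Cell)) :=
  (Computable.const []).pair ((c_getD fst snd).pair (Computable.const s))

theorem c_crun (hM : M.Computable') {k n : α → ℕ} {x : α → List ℕ} (hk : Computable k)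
    (hx : Computable x) (hn : Computable n) :
    Computable (fun a => crun M (k a) (x a) (n a)) :=
  c_crun_aux (c_cstep hM) (c_init M.s) hk hx hn

theorem c_adjB (hM : M.Computable') : Computable₂ (adjB M) := by
  refine c_and ((c_gB hM).comp snd) (c_or (c_not (c_eq ?_ (Computable.const [])))
    (c_not (c_eq ?_ (Computable.const []))))
  · exact (c_E hM).comp fst snd
  · exact (c_E hM).comp snd fst

theorem c_satB (hM : M.Computable') : Computable₂ (satB M) := by
  have h : Computable₂ (fun (p : List ℕ × ℕ) (w : ℕ) => adjB M p.2 w) :=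
    (c_adjB hM).comp (snd.comp fst) snd
  exact c_eq (list_length.comp (c_filter (c_range (list_length.comp fst)) h))
    (c_getD fst snd)

theorem c_haltB (hM : M.Computable') {k n v : α → ℕ} {x : α → List ℕ} (hk : Computable k)
    (hx : Computable x) (hn : Computable n) (hv : Computable v) :
    Computable (fun a => haltB M (k a) (x a) (n a) (v a)) := by
  refine c_or (c_not ((c_gB hM).comp hv)) (c_eq ?_ ?_)
  · exact c_cell.comp (c_crun hM hk hx (Computable.succ.comp hn)) hv
  · exact c_cell.comp (c_crun hM hk hx hn) hv

theorem c_satOK (hM : M.Computable') {m v : α → ℕ} {σ x : α → List ℕ} (hs : Computable σ)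
    (hx : Computable x) (hm : Computable m) (hv : Computable v) :
    Computable (fun a => satOK M (σ a) (x a) (m a) (v a)) := by
  refine c_or (c_not ((c_gB hM).comp hv)) (c_or (c_eq ?_ (Computable.const []))
    ((c_satB hM).comp hs hv))
  exact fst.comp (c_cell.comp (c_crun hM (list_length.comp hs) hx hm) hv)

theorem c_chk (hM : M.Computable') {n : α → ℕ} {x σ : α → List ℕ} (hx : Computable x)
    (hs : Computable σ) (hn : Computable n) :
    Computable (fun a => chk M (x a) (σ a) (n a)) := by
  have hl : Computable (fun a => (σ a).length) := list_length.comp hs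
  have h1 : Computable₂ (fun (a : α) (v : ℕ) => haltB M (σ a).length (x a) (n a) v) :=
    c_haltB hM (hl.comp fst) (hx.comp fst) (hn.comp fst) snd
  have h2 : Computable₂ (fun (p : α × ℕ) (v : ℕ) => satOK M (σ p.1) (x p.1) p.2 v) :=
    c_satOK hM (hs.comp (fst.comp fst)) (hx.comp (fst.comp fst)) (snd.comp fst) snd
  have h3 : Computable₂ (fun (a : α) (m : ℕ) =>
      (List.range (σ a).length).all (satOK M (σ a) (x a) m)) :=
    c_all (c_range (hl.comp fst)) h2
  exact c_and (c_all (c_range hl) h1) (c_all (c_range (Computable.succ.comp hn)) h3)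

theorem c_goodB (hM : M.Computable') : Computable (goodB M) := by
  have h : Computable₂ (domB M) := by
    refine Computable.cond ((c_gB hM).comp snd) ?_ ?_
    · exact c_mem (Computable.const _) (c_getD fst snd)
    · exact c_eq (c_getD fst snd) (Computable.const 0)
  exact c_all (c_range list_length) h

theorem c_srch (hM : M.Computable') : Computable (srch M) := by
  have hx : Computable (fun q : ℕ × List ℕ × ℕ => Denumerable.ofNat (List ℕ) q.1.unpair.1) :=
    (Computable.ofNat (List ℕ)).comp (fst.comp (Computable.unpair.comp fst))
  have hv : Computable (fun q : ℕ × List ℕ × ℕ => q.1.unpair.2) :=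
    snd.comp (Computable.unpair.comp fst)
  have hs : Computable (fun q : ℕ × List ℕ × ℕ => q.2.1) := fst.comp snd
  have hn : Computable (fun q : ℕ × List ℕ × ℕ => q.2.2) := snd.comp snd
  have hl := list_length.comp hs
  refine Computable.cond (c_and ((c_goodB hM).comp hx) ((c_gB hM).comp hv))
    (Computable.cond (c_and (c_and ?_ ?_) (c_chk hM hx hs hn)) ?_ (Computable.const 0))
    (Computable.const 1)
  · exact c_eq (c_sub (list_length.comp hx) hl) (Computable.const 0)
  · exact c_eq (c_sub (Computable.succ.comp hv) hl) (Computable.const 0)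
  · exact Computable.succ.comp (fst.comp (snd.comp (c_cell.comp (c_crun hM hl hx hn) hv)))

end comp

end S15

/-- If the computable graph machine `M` has underlying graph of
finite degree and `{M}` is total, then `{M}` is computable from the degree function,
and every output of `{M}` lies in `𝔄^{<G}` (values in the alphabet, displaying `0`
on all but finitely many vertices of `G`). -/
theorem stmt15 (M : GraphMachine) (hM : M.Computable')
    (hfd : M.graph.FiniteDegree) (hT : M.Total) :
    TuringLE M.fn M.graph.degFun ∧
    ∀ x : ℕ → ℕ, M.InDom x →
      {v ∈ M.graph.G | M.outputAt x v ≠ 0}.Finite ∧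
      ∀ v ∈ M.graph.G, M.outputAt x v ∈ M.A := by
  refine ⟨S15.tle_of_search _ _ (S15.srch M) (S15.c_srch hM) (S15.srch_sound M hfd)
    (S15.srch_complete M hfd hT), fun x hx => ?_⟩
  obtain ⟨n, hn⟩ := hT x hx
  refine ⟨(S15.active_finite hfd hx n).subset ?_, fun v hv => ?_⟩
  · rintro v ⟨hv, hne⟩
    rw [S15.output_eq hn hv] at hne
    exact ⟨hv, fun h => hne (by rw [h])⟩
  · rw [S15.output_eq hn hv]
    exact (S15.run_valid hx n v hv).1

end
end
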